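/- arXiv:2310.04969 — 3 statements merged into one kernel-verified Lean document; each statement's English description precedes it below -/
import Mathlib

section
/- For every n ≥ 1, the binomial-Stirling-Eulerian polynomial satisfies Ã_n(x,y|α) = ∑_{k=0}^{⌊n/2⌋} γ̃_{n,k}(α) (xy)^k (x+y)^{n−2k} as an identity of polynomials in ℤ[x,y,α], where γ̃_{n,k}(α) = ∑_{σ∈Γ_{n,k}} α^{LRmin(σ)+RLmin(σ)−2} and Γ_{n,k} is the set of permutations σ ∈ PRW_{n+1} with asc(σ) = k and da(σ) = 0 (no double ascents). -/
/-- The letter at (1-based) position `i` of the word `w`, with the boundary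
convention that positions `0` and `> w.length` carry the value `w.length + 1`
(playing the role of `+∞` for a permutation word of `{1,…,n}`). -/
def wB (w : List ℕ) (i : ℕ) : ℕ :=
  if 1 ≤ i ∧ i ≤ w.length then w.getD (i - 1) 0 else w.length + 1

/-- The one-line word `σ_1 ⋯ σ_n` (with letters in `{1,…,n}`) of a permutation of `Fin n`. -/
def word {n : ℕ} (σ : Equiv.Perm (Fin n)) : List ℕ := List.ofFn (fun i => (σ i : ℕ) + 1)

/-- Number of descents: indices `i ∈ {1,…,n-1}` with `σ_i > σ_{i+1}`. -/
def desW (w : List ℕ) : ℕ :=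
  ((Finset.Icc 1 (w.length - 1)).filter (fun i => wB w (i + 1) < wB w i)).card

/-- Number of ascents: indices `i ∈ {1,…,n-1}` with `σ_i < σ_{i+1}`. -/
def ascW (w : List ℕ) : ℕ :=
  ((Finset.Icc 1 (w.length - 1)).filter (fun i => wB w i < wB w (i + 1))).card

/-- Position `i` is a double ascent: `σ_{i-1} < σ_i < σ_{i+1}` (boundary `σ_0 = σ_{n+1} = +∞`). -/
abbrev isDAat (w : List ℕ) (i : ℕ) : Prop := wB w (i - 1) < wB w i ∧ wB w i < wB w (i + 1)

/-- Position `i` is a double descent: `σ_{i-1} > σ_i > σ_{i+1}`. -/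
abbrev isDDat (w : List ℕ) (i : ℕ) : Prop := wB w i < wB w (i - 1) ∧ wB w (i + 1) < wB w i

/-- Position `i` is a peak: `σ_{i-1} < σ_i > σ_{i+1}`. -/
abbrev isPkat (w : List ℕ) (i : ℕ) : Prop := wB w (i - 1) < wB w i ∧ wB w (i + 1) < wB w i

/-- Position `i` is a valley: `σ_{i-1} > σ_i < σ_{i+1}`. -/
abbrev isVlat (w : List ℕ) (i : ℕ) : Prop := wB w i < wB w (i - 1) ∧ wB w i < wB w (i + 1)

/-- Position `i` holds a left-to-right minimum: `σ_j > σ_i` for all `j < i`. -/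
abbrev isLRat (w : List ℕ) (i : ℕ) : Prop := ∀ j ∈ Finset.Icc 1 (i - 1), wB w i < wB w j

/-- Position `i` holds a right-to-left minimum: `σ_j > σ_i` for all `j > i`. -/
abbrev isRLat (w : List ℕ) (i : ℕ) : Prop := ∀ j ∈ Finset.Icc (i + 1) w.length, wB w i < wB w j

/-- `da`, the number of double ascents. -/
def daW (w : List ℕ) : ℕ := ((Finset.Icc 1 w.length).filter (isDAat w)).card

/-- `dd`, the number of double descents. -/
def ddW (w : List ℕ) : ℕ := ((Finset.Icc 1 w.length).filter (isDDat w)).card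

/-- `M`, the number of peaks. -/
def pkW (w : List ℕ) : ℕ := ((Finset.Icc 1 w.length).filter (isPkat w)).card

/-- `LRmin`, the number of left-to-right minima. -/
def lrminW (w : List ℕ) : ℕ := ((Finset.Icc 1 w.length).filter (isLRat w)).card

/-- `RLmin`, the number of right-to-left minima. -/
def rlminW (w : List ℕ) : ℕ := ((Finset.Icc 1 w.length).filter (isRLat w)).card

/-- The word belongs to `PRW`: if it has an ascent, the first ascent occurs at the letter `1`. -/
abbrev isPRW (w : List ℕ) : Prop :=
  ∀ i ∈ Finset.Icc 1 (w.length - 1), wB w i < wB w (i + 1) →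
    (∀ j ∈ Finset.Icc 1 (i - 1), ¬ wB w j < wB w (j + 1)) → wB w i = 1

/-- The set `PRW_n` of permutations whose first ascent (if any) appears at the letter `1`. -/
def PRW (n : ℕ) : Finset (Equiv.Perm (Fin n)) :=
  Finset.univ.filter (fun σ => isPRW (word σ))

namespace PRWGamma

open MvPolynomial

/-- The ring of weights: `X 0, X 1, X 2` mark double ascents, double descents and peaks to the
right of the letter `1`, `X 3` marks left-to-right and right-to-left minima other than `1`, and
`X 4` marks the letters to the left of `1`. -/
abbrev Weight : Type := MvPolynomial (Fin 5) ℤ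

/-- The weight of a letter entered by an ascent iff `b` and left by an ascent iff `c`. -/
noncomputable def letterWeight : Bool → Bool → Weight
  | true, true => X 0
  | false, false => X 1
  | true, false => X 2
  | false, true => 1

/-- The weight of a word `a :: l` to the right of the letter `1`, whose first letter is entered
by an ascent iff `b`. -/
noncomputable def tailWeight : Bool → ℕ → List ℕ → Weight
  | b, _, [] => letterWeight b true * X 3
  | b, a, c :: l => letterWeight b (decide (a < c)) *
      (if ∀ x ∈ c :: l, a < x then X 3 else 1) * tailWeight (decide (a < c)) c l

/-- The weight of a word, equal to zero unless its first ascent is at the letter `1`. -/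
noncomputable def wordWeight : List ℕ → Weight
  | [] => 0
  | [a] => if a = 1 then 1 else 0
  | a :: c :: l => if a = 1 then tailWeight true c l
      else if c < a then X 4 * X 3 * wordWeight (c :: l) else 0

/-- The derivation describing the insertion of a new maximum in the interior of a word. -/
noncomputable def insertionDerivation : Derivation ℤ Weight Weight :=
  mkDerivation ℤ ![X 2, X 2, (X 0 + X 1) * X 2, 0, 0]

lemma perm_of_mem_permutations'Aux {M : ℕ} {l l' : List ℕ}
    (h : l' ∈ List.permutations'Aux M l) : l'.Perm (M :: l) := by
  induction l generalizing l' with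
  | nil => simp_all
  | cons c l ih =>
    simp only [List.permutations'Aux, List.mem_cons, List.mem_map] at h
    rcases h with rfl | ⟨t, ht, rfl⟩
    · rfl
    · exact ((ih ht).cons c).trans (.swap _ _ _)

lemma insertionDerivation_X0 : insertionDerivation (X 0) = X 2 := by
  simp [insertionDerivation, mkDerivation_X]

lemma insertionDerivation_X1 : insertionDerivation (X 1) = X 2 := by
  simp [insertionDerivation, mkDerivation_X]

lemma insertionDerivation_X2 : insertionDerivation (X 2) = (X 0 + X 1) * X 2 := by
  simp [insertionDerivation, mkDerivation_X]

lemma insertionDerivation_X3 : insertionDerivation (X 3) = 0 := by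
  simp [insertionDerivation, mkDerivation_X]

lemma insertionDerivation_X4 : insertionDerivation (X 4) = 0 := by
  simp [insertionDerivation, mkDerivation_X]

lemma insertionDerivation_ite (p : Prop) [Decidable p] :
    insertionDerivation (if p then X 3 else 1) = 0 := by
  split_ifs <;> simp [insertionDerivation_X3]

lemma sum_tailWeight_insert {M : ℕ} (b : Bool) (a : ℕ) (l : List ℕ) (ha : a < M)
    (hl : ∀ x ∈ l, x < M) :
    ((List.permutations'Aux M l).map (tailWeight b a)).sum
        + (if b then X 2 * tailWeight false a l else 0)
      = insertionDerivation (tailWeight b a l) + X 3 * X 0 * tailWeight b a l := by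
  induction l generalizing b a with
  | nil =>
    cases b <;> simp [tailWeight, letterWeight, ha, Derivation.leibniz, insertionDerivation_X0,
      insertionDerivation_X3] <;> ring
  | cons c l ih =>
    have hc : c < M := hl c (by simp)
    have hM : ¬ M < c := by omega
    have key : ((List.permutations'Aux M l).map (fun t => tailWeight b a (c :: t))).sum
        = letterWeight b (decide (a < c)) * (if ∀ x ∈ c :: l, a < x then X 3 else 1) *
          ((List.permutations'Aux M l).map (tailWeight (decide (a < c)) c)).sum := by
      rw [← List.sum_map_mul_left]
      congr 1
      apply List.map_congr_left
      intro t ht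
      have hiff : (∀ x ∈ c :: t, a < x) ↔ ∀ x ∈ c :: l, a < x := by
        simp [(perm_of_mem_permutations'Aux ht).mem_iff, ha]
      simp only [tailWeight, hiff]
    have h1 := ih (decide (a < c)) c hc (fun x hx => hl x (by simp [hx]))
    have h2 : tailWeight b a (M :: c :: l) = letterWeight b true *
        (if ∀ x ∈ c :: l, a < x then X 3 else 1) * (X 2 * tailWeight false c l) := by
      have : ∃ x ∈ c :: l, ¬ M < x := ⟨c, by simp, hM⟩
      have hM' : ¬ ∀ x ∈ c :: l, M < x := by push Not at this ⊢; exact this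
      have hiff : (∀ x ∈ M :: c :: l, a < x) ↔ ∀ x ∈ c :: l, a < x := by simp [ha]
      rw [tailWeight, tailWeight]
      simp only [hiff, hM', if_false, hM, ha, decide_true, decide_false, letterWeight]
      ring
    simp only [List.permutations'Aux, List.map_cons, List.sum_cons, List.map_map,
      Function.comp_def, key, h2]
    rw [tailWeight, tailWeight]
    generalize hr : (if ∀ x ∈ c :: l, a < x then (X 3 : Weight) else 1) = r
    have hDr : insertionDerivation r = 0 := by rw [← hr]; exact insertionDerivation_ite _
    rw [← eq_sub_iff_add_eq] at h1
    rw [h1]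
    by_cases hac : a < c <;> cases b <;>
      simp [hac, letterWeight, Derivation.leibniz, hDr, insertionDerivation_X0,
        insertionDerivation_X1, insertionDerivation_X2] <;> ring

lemma sum_wordWeight_insert {M : ℕ} (l : List ℕ) (hM : 1 < M) (hl0 : l ≠ [])
    (hl : ∀ x ∈ l, x < M) :
    ((List.permutations'Aux M l).map wordWeight).sum
      = insertionDerivation (wordWeight l) + X 3 * (X 0 + X 4) * wordWeight l := by
  induction l with
  | nil => simp at hl0
  | cons a l ih =>
    have ha : a < M := hl a (by simp)
    have hM1 : M ≠ 1 := by omega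
    have hMa : ¬ M < a := by omega
    cases l with
    | nil =>
      by_cases h : a = 1
      · subst h
        simp [wordWeight, hM1, ha, tailWeight, letterWeight]
        ring
      · simp [wordWeight, h, hM1, ha]
    | cons c l =>
      have hc : c < M := hl c (by simp)
      have hl' : ∀ x ∈ l, x < M := fun x hx => hl x (by simp [hx])
      have hMc : ¬ M < c := by omega
      by_cases h : a = 1
      · have h1 := sum_tailWeight_insert true c l hc hl'
        have h2 : tailWeight true M (c :: l) = X 2 * tailWeight false c l := by
          have : ∃ x ∈ c :: l, ¬ M < x := ⟨c, by simp, hMc⟩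
          have hM' : ¬ ∀ x ∈ c :: l, M < x := by push Not at this ⊢; exact this
          rw [tailWeight]
          simp only [hM', if_false, hMc, decide_false, letterWeight]
          ring
        subst h
        simp only [if_true] at h1
        simp [List.permutations'Aux, wordWeight, Function.comp_def, h2, hM1, hM]
        rw [← eq_sub_iff_add_eq] at h1
        have h3 : (List.map (fun x => tailWeight true c x) (List.permutations'Aux M l)).sum
          = _ := h1
        rw [h3]
        ring
      · have h1 := ih (by simp) (fun x hx => hl x (by simp [hx]))
        simp only [List.permutations'Aux, List.map_cons, List.sum_cons, List.map_map,
          Function.comp_def, wordWeight, h, hM1, if_false, ha, hc, if_true, not_lt.2 ha.le] at h1 ⊢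
        by_cases hca : c < a
        · simp only [hca, if_true, List.sum_map_mul_left, Derivation.leibniz, insertionDerivation_X3,
            insertionDerivation_X4, smul_eq_mul, mul_zero, add_zero]
          rw [← eq_sub_iff_add_eq'] at h1
          rw [h1]
          ring
        · simp [hca]

/-- The word `n ⋯ 2 1`. -/
def descList : ℕ → List ℕ
  | 0 => []
  | n + 1 => (n + 1) :: descList n

lemma mem_descList {n x : ℕ} : x ∈ descList n ↔ 1 ≤ x ∧ x ≤ n := by
  induction n with
  | zero => simp [descList]; omega
  | succ n ih => simp [descList, ih]; omega

lemma nodup_descList (n : ℕ) : (descList n).Nodup := by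
  induction n with
  | zero => simp [descList]
  | succ n ih => simp [descList, ih, mem_descList]

lemma length_descList (n : ℕ) : (descList n).length = n := by
  induction n with
  | zero => simp [descList]
  | succ n ih => simp [descList, ih]

/-- The total weight of the permutations of `{1,…,n+1}`. -/
noncomputable def totalWeight (n : ℕ) : Weight :=
  ((descList (n + 1)).permutations'.map wordWeight).sum

lemma totalWeight_succ (n : ℕ) : totalWeight (n + 1)
    = insertionDerivation (totalWeight n) + X 3 * (X 0 + X 4) * totalWeight n := by
  have h : ∀ L : List (List ℕ), (∀ l ∈ L, l.Perm (descList (n + 1))) →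
      ((L.flatMap (List.permutations'Aux (n + 2))).map wordWeight).sum
        = insertionDerivation (L.map wordWeight).sum
          + X 3 * (X 0 + X 4) * (L.map wordWeight).sum := by
    intro L hL
    induction L with
    | nil => simp
    | cons l L ih =>
      have hl := hL l (by simp)
      have h1 : l ≠ [] := by
        rintro rfl
        simp [descList] at hl
      have h2 : ∀ x ∈ l, x < n + 2 := by
        intro x hx
        rw [hl.mem_iff, mem_descList] at hx
        omega
      simp only [List.flatMap_cons, List.map_append, List.sum_append, List.map_cons,
        List.sum_cons, map_add]
      rw [sum_wordWeight_insert l (by omega) h1 h2, ih (fun l' h' => hL l' (by simp [h']))]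
      ring
  exact h _ (fun l hl => List.mem_permutations'.1 hl)

/-- The polynomials depending on `X 0`, `X 1`, `X 4` through `X 0 + X 1` and `X 0 + X 4` only. -/
noncomputable def sumSubalgebra : Subalgebra ℤ Weight :=
  Algebra.adjoin ℤ {X 0 + X 1, X 0 + X 4, X 2, X 3}

lemma insertionDerivation_mem {p : Weight} (hp : p ∈ sumSubalgebra) :
    insertionDerivation p ∈ sumSubalgebra := by
  have h2 : (X 2 : Weight) ∈ sumSubalgebra := Algebra.subset_adjoin (by simp)
  have hs : (X 0 + X 1 : Weight) ∈ sumSubalgebra := Algebra.subset_adjoin (by simp)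
  induction hp using Algebra.adjoin_induction with
  | mem x hx =>
    rcases hx with rfl | rfl | rfl | rfl
    · rw [map_add, insertionDerivation_X0, insertionDerivation_X1]
      exact add_mem h2 h2
    · rw [map_add, insertionDerivation_X0, insertionDerivation_X4, add_zero]
      exact h2
    · rw [insertionDerivation_X2]
      exact mul_mem hs h2
    · rw [insertionDerivation_X3]
      exact zero_mem _
  | algebraMap r => simp
  | add x y _ _ hx hy => rw [map_add]; exact add_mem hx hy
  | mul x y hx' hy' hx hy =>
    rw [Derivation.leibniz]
    exact add_mem (mul_mem hx' hy) (mul_mem hy' hx)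

lemma totalWeight_mem (n : ℕ) : totalWeight n ∈ sumSubalgebra := by
  induction n with
  | zero => simp [totalWeight, descList, wordWeight]
  | succ n ih =>
    rw [totalWeight_succ]
    exact add_mem (insertionDerivation_mem ih) (mul_mem (mul_mem
      (Algebra.subset_adjoin (by simp)) (Algebra.subset_adjoin (by simp))) ih)

/-- The specialization of the weights giving descents and ascents. -/
noncomputable def eulerianEval : Weight →ₐ[ℤ] MvPolynomial (Fin 3) ℤ :=
  aeval ![X 1, X 0, X 0 * X 1, X 2, X 0]

/-- The specialization of the weights that kills double ascents. -/
noncomputable def gammaEval : Weight →ₐ[ℤ] MvPolynomial (Fin 3) ℤ :=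
  aeval ![0, X 0 + X 1, X 0 * X 1, X 2, X 0 + X 1]

lemma eulerianEval_totalWeight (n : ℕ) :
    eulerianEval (totalWeight n) = gammaEval (totalWeight n) := by
  have h : sumSubalgebra ≤ AlgHom.equalizer eulerianEval gammaEval := by
    refine Algebra.adjoin_le ?_
    rintro x (rfl | rfl | rfl | rfl) <;>
      simp [eulerianEval, gammaEval, add_comm]
  exact h (totalWeight_mem n)

lemma word_perm_descList {n : ℕ} (σ : Equiv.Perm (Fin n)) : (word σ).Perm (descList n) := by
  rw [List.perm_ext_iff_of_nodup _ (nodup_descList n)]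
  · intro x
    simp only [word, List.mem_ofFn, mem_descList]
    constructor
    · rintro ⟨i, rfl⟩
      have := (σ i).isLt
      omega
    · rintro ⟨h1, h2⟩
      exact ⟨σ.symm ⟨x - 1, by omega⟩, by simp; omega⟩
  · rw [word, List.nodup_ofFn]
    intro i j hij
    apply σ.injective
    ext
    simpa using hij

lemma word_injective {n : ℕ} : Function.Injective (word (n := n)) := by
  intro σ τ h
  ext i
  have := congrFun (List.ofFn_injective h) i
  simpa using this

lemma image_word (n : ℕ) :
    (Finset.univ : Finset (Equiv.Perm (Fin n))).image word = (descList n).permutations'.toFinset := by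
  apply Finset.eq_of_subset_of_card_le
  · intro l hl
    obtain ⟨σ, -, rfl⟩ := Finset.mem_image.1 hl
    simpa using word_perm_descList σ
  · rw [Finset.card_image_of_injective _ word_injective, Finset.card_univ, Fintype.card_perm,
      Fintype.card_fin]
    refine (List.toFinset_card_le _).trans ?_
    rw [(List.permutations_perm_permutations' _).symm.length_eq, List.length_permutations,
      length_descList]

lemma nodup_permutations'_descList (n : ℕ) : (descList n).permutations'.Nodup :=
  (List.permutations_perm_permutations' _).nodup (List.nodup_permutations _ (nodup_descList n))

lemma sum_perm_eq_sum_permutations' {A : Type*} [AddCommMonoid A] (n : ℕ) (f : List ℕ → A) :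
    ∑ σ : Equiv.Perm (Fin n), f (word σ) = ((descList n).permutations'.map f).sum := by
  rw [← List.sum_toFinset f (nodup_permutations'_descList n), ← image_word,
    Finset.sum_image (word_injective.injOn)]

lemma card_filter_Icc_one_succ (n : ℕ) (p : ℕ → Prop) [DecidablePred p] :
    ((Finset.Icc 1 (n + 1)).filter p).card
      = (if p 1 then 1 else 0) + ((Finset.Icc 1 n).filter (fun i => p (i + 1))).card := by
  simp only [Finset.card_filter]
  induction n with
  | zero => rw [zero_add, Finset.Icc_self, Finset.sum_singleton]; simp
  | succ n ih =>
    rw [Finset.sum_Icc_succ_top (by omega), ih, Finset.sum_Icc_succ_top (by omega), add_assoc]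

lemma wB_eq_getElem {l : List ℕ} {i : ℕ} (h : i < l.length) : wB l (i + 1) = l[i] := by
  have h1 : 1 ≤ i + 1 ∧ i + 1 ≤ l.length := by omega
  simp [wB, h1, h]

lemma wB_cons_one (a : ℕ) (l : List ℕ) : wB (a :: l) 1 = a := by
  simp [wB]

lemma wB_cons_succ (a : ℕ) {l : List ℕ} {i : ℕ} (h1 : 1 ≤ i) (h2 : i ≤ l.length) :
    wB (a :: l) (i + 1) = wB l i := by
  obtain ⟨i, rfl⟩ := Nat.exists_eq_add_of_le' h1
  rw [wB_eq_getElem (by simpa using h2), wB_eq_getElem (by omega), List.getElem_cons_succ]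

lemma wB_mem {l : List ℕ} {i : ℕ} (h1 : 1 ≤ i) (h2 : i ≤ l.length) : wB l i ∈ l := by
  obtain ⟨i, rfl⟩ := Nat.exists_eq_add_of_le' h1
  rw [wB_eq_getElem (by omega)]
  exact List.getElem_mem _

lemma wB_eq_getD (l : List ℕ) (i : ℕ) :
    wB l i = ((l.length + 1) :: l).getD i (l.length + 1) := by
  rcases i with _ | i
  · simp [wB]
  · by_cases h : i < l.length
    · rw [wB_eq_getElem h]
      simp [h]
    · have : ¬ i + 1 ≤ l.length := by omega
      simp [wB, this]

lemma desW_cons_cons (a c : ℕ) (l : List ℕ) :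
    desW (a :: c :: l) = (if c < a then 1 else 0) + desW (c :: l) := by
  simp only [desW, List.length_cons, Nat.add_sub_cancel]
  rw [card_filter_Icc_one_succ, wB_cons_one, wB_cons_succ a le_rfl (by simp), wB_cons_one]
  congr 2
  apply Finset.filter_congr
  intro i hi
  rw [Finset.mem_Icc] at hi
  rw [wB_cons_succ a (by omega) (by simp; omega), wB_cons_succ a (by omega) (by simp; omega)]

lemma ascW_cons_cons (a c : ℕ) (l : List ℕ) :
    ascW (a :: c :: l) = (if a < c then 1 else 0) + ascW (c :: l) := by
  simp only [ascW, List.length_cons, Nat.add_sub_cancel]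
  rw [card_filter_Icc_one_succ, wB_cons_one, wB_cons_succ a le_rfl (by simp), wB_cons_one]
  congr 2
  apply Finset.filter_congr
  intro i hi
  rw [Finset.mem_Icc] at hi
  rw [wB_cons_succ a (by omega) (by simp; omega), wB_cons_succ a (by omega) (by simp; omega)]

lemma desW_singleton (a : ℕ) : desW [a] = 0 := by simp [desW]

lemma ascW_singleton (a : ℕ) : ascW [a] = 0 := by simp [ascW]

lemma rlminW_cons (a : ℕ) (l : List ℕ) :
    rlminW (a :: l) = (if ∀ x ∈ l, a < x then 1 else 0) + rlminW l := by
  simp only [rlminW, List.length_cons]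
  rw [card_filter_Icc_one_succ]
  congr 1
  · congr 1
    apply propext
    simp only [isRLat, wB_cons_one, Finset.mem_Icc, List.length_cons]
    constructor
    · intro h x hx
      obtain ⟨i, hi, rfl⟩ := List.getElem_of_mem hx
      have := h (i + 2) (by omega)
      rwa [wB_cons_succ a (by omega) (by omega), wB_eq_getElem hi] at this
    · intro h j hj
      obtain ⟨j, rfl⟩ := Nat.exists_eq_add_of_le' (show 1 ≤ j by omega)
      rw [wB_cons_succ a (by omega) (by omega)]
      exact h _ (wB_mem (by omega) (by omega))
  · congr 1
    apply Finset.filter_congr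
    intro i hi
    rw [Finset.mem_Icc] at hi
    simp only [isRLat, Finset.mem_Icc, List.length_cons]
    rw [wB_cons_succ a hi.1 hi.2]
    constructor
    · intro h j hj
      have := h (j + 1) (by omega)
      rwa [wB_cons_succ a (by omega) (by omega)] at this
    · intro h j hj
      obtain ⟨j, rfl⟩ := Nat.exists_eq_add_of_le' (show 1 ≤ j by omega)
      rw [wB_cons_succ a (by omega) (by omega)]
      exact h j (by omega)

lemma rlminW_nil : rlminW [] = 0 := by simp [rlminW]

lemma one_le_rlminW (a : ℕ) (l : List ℕ) : 1 ≤ rlminW (a :: l) := by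
  induction l generalizing a with
  | nil => simp [rlminW_cons]
  | cons c l ih =>
    rw [rlminW_cons]
    exact (ih c).trans (Nat.le_add_left _ _)

lemma lrminW_cons_cons {a c : ℕ} (l : List ℕ) (h : c < a) :
    lrminW (a :: c :: l) = 1 + lrminW (c :: l) := by
  simp only [lrminW, List.length_cons]
  rw [card_filter_Icc_one_succ, if_pos (by simp [isLRat])]
  congr 2
  apply Finset.filter_congr
  intro i hi
  rw [Finset.mem_Icc] at hi
  simp only [isLRat, Finset.mem_Icc]
  rw [wB_cons_succ a hi.1 (by simp; omega)]
  constructor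
  · intro H j hj
    have := H (j + 1) (by omega)
    rwa [wB_cons_succ a (by omega) (by simp; omega)] at this
  · intro H j hj
    obtain ⟨j, rfl⟩ := Nat.exists_eq_add_of_le' (show 1 ≤ j by omega)
    rcases Nat.eq_zero_or_pos j with rfl | hj0
    · rw [wB_cons_one]
      rcases hi.1.eq_or_lt with rfl | h1
      · rwa [wB_cons_one]
      · have := H 1 (by omega)
        rw [wB_cons_one] at this
        omega
    · rw [wB_cons_succ a (by omega) (by simp; omega)]
      exact H j (by omega)

lemma lrminW_one_cons {l : List ℕ} (h : ∀ x ∈ l, 1 ≤ x) : lrminW (1 :: l) = 1 := by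
  simp only [lrminW, List.length_cons]
  rw [card_filter_Icc_one_succ, if_pos (by simp [isLRat]), Finset.filter_false_of_mem]
  · simp
  · intro i hi H
    rw [Finset.mem_Icc] at hi
    have h1 := H 1 (by simp; omega)
    rw [wB_cons_one, wB_cons_succ 1 hi.1 hi.2] at h1
    have := h _ (wB_mem hi.1 hi.2)
    omega

lemma isPRW_one_cons {l : List ℕ} (h : ∀ x ∈ l, 1 < x) : isPRW (1 :: l) := by
  intro i hi _ hj
  simp only [Finset.mem_Icc, List.length_cons, Nat.add_sub_cancel] at hi hj
  rcases hi.1.eq_or_lt with rfl | h1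
  · exact wB_cons_one _ _
  · refine absurd ?_ (hj 1 (by omega))
    rw [wB_cons_one, wB_cons_succ 1 le_rfl (by omega)]
    exact h _ (wB_mem le_rfl (by omega))

lemma not_isPRW_cons_cons {a c : ℕ} (l : List ℕ) (ha : a ≠ 1) (h : a < c) :
    ¬ isPRW (a :: c :: l) := by
  intro H
  have := H 1 (by simp) (by rwa [wB_cons_one, wB_cons_succ a le_rfl (by simp), wB_cons_one])
    (by simp)
  rw [wB_cons_one] at this
  exact ha this

lemma isPRW_cons_cons {a c : ℕ} (l : List ℕ) (h : c < a) :
    isPRW (a :: c :: l) ↔ isPRW (c :: l) := by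
  have h0 : ¬ wB (a :: c :: l) 1 < wB (a :: c :: l) (1 + 1) := by
    rw [wB_cons_one, wB_cons_succ a le_rfl (by simp), wB_cons_one]
    omega
  simp only [isPRW, Finset.mem_Icc, List.length_cons, Nat.add_sub_cancel]
  constructor
  · intro H i hi h1 h2
    have := H (i + 1) (by omega)
    rw [wB_cons_succ a (by omega) (by simp; omega), wB_cons_succ a (by omega) (by simp; omega)]
      at this
    refine this h1 fun j hj => ?_
    obtain ⟨j, rfl⟩ := Nat.exists_eq_add_of_le' (show 1 ≤ j by omega)
    rcases Nat.eq_zero_or_pos j with rfl | hj0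
    · exact h0
    · rw [wB_cons_succ a (by omega) (by simp; omega), wB_cons_succ a (by omega) (by simp; omega)]
      exact h2 j (by omega)
  · intro H i hi h1 h2
    obtain ⟨i, rfl⟩ := Nat.exists_eq_add_of_le' (show 1 ≤ i by omega)
    rcases Nat.eq_zero_or_pos i with rfl | hi0
    · exact absurd h1 h0
    · rw [wB_cons_succ a (by omega) (by simp; omega), wB_cons_succ a (by omega) (by simp; omega)]
        at h1
      rw [wB_cons_succ a (by omega) (by simp; omega)]
      refine H i (by omega) h1 fun j hj => ?_
      have := h2 (j + 1) (by omega)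
      rwa [wB_cons_succ a (by omega) (by simp; omega), wB_cons_succ a (by omega) (by simp; omega)]
        at this

/-- The number of double ascents of a word `a :: l` whose first letter is entered by an ascent
iff `b`. -/
def daTail : Bool → ℕ → List ℕ → ℕ
  | b, _, [] => b.toNat
  | b, a, c :: l => (b && decide (a < c)).toNat + daTail (decide (a < c)) c l

lemma card_doubleAscents {N p a : ℕ} {l : List ℕ} (ha : a < N) (hl : ∀ x ∈ l, x < N) :
    ((Finset.Icc 1 (l.length + 1)).filter (fun i =>
      (p :: a :: l).getD (i - 1) N < (p :: a :: l).getD i N ∧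
        (p :: a :: l).getD i N < (p :: a :: l).getD (i + 1) N)).card
      = daTail (decide (p < a)) a l := by
  induction l generalizing p a with
  | nil =>
    by_cases h : p < a <;>
      simp [Finset.filter_singleton, daTail, h, ha]
  | cons c l ih =>
    rw [List.length_cons, card_filter_Icc_one_succ, daTail,
      ← ih (hl c (by simp)) (fun x hx => hl x (by simp [hx]))]
    congr 1
    · by_cases h : p < a <;> by_cases h' : a < c <;> simp [h, h']
    · congr 1
      apply Finset.filter_congr
      intro i hi
      rw [Finset.mem_Icc] at hi
      obtain ⟨i, rfl⟩ := Nat.exists_eq_add_of_le' hi.1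
      simp only [Nat.add_sub_cancel, List.getD_cons_succ]

lemma daW_cons {a : ℕ} {l : List ℕ} (h : ∀ x ∈ a :: l, x ≤ l.length + 1) :
    daW (a :: l) = daTail false a l := by
  have ha : a ≤ l.length + 1 := h a (by simp)
  have hl : ∀ x ∈ l, x < l.length + 2 := fun x hx => Nat.lt_succ_of_le (h x (by simp [hx]))
  have h1 : decide (l.length + 2 < a) = false := by simp; omega
  rw [← h1, ← card_doubleAscents (Nat.lt_succ_of_le ha) hl]
  simp only [daW, isDAat, wB_eq_getD, List.length_cons]

lemma eulerianEval_tailWeight (b : Bool) (a : ℕ) (l : List ℕ) (h : (a :: l).Nodup) :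
    eulerianEval (tailWeight b a l) = X 1 ^ b.toNat * X 0 ^ desW (a :: l) * X 1 ^ ascW (a :: l)
      * X 2 ^ rlminW (a :: l) := by
  induction l generalizing b a with
  | nil =>
    cases b <;> simp [tailWeight, letterWeight, eulerianEval, desW_singleton, ascW_singleton,
      rlminW_cons, rlminW_nil]
  | cons c l ih =>
    have hac : a ≠ c := by rintro rfl; simp at h
    have hr : eulerianEval (if ∀ x ∈ c :: l, a < x then X 3 else 1)
        = X 2 ^ (if ∀ x ∈ c :: l, a < x then 1 else 0) := by
      split_ifs <;> simp [eulerianEval]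
    rw [tailWeight, map_mul, map_mul, ih _ _ h.of_cons, hr, rlminW_cons a, desW_cons_cons,
      ascW_cons_cons]
    rcases lt_or_gt_of_ne hac with h1 | h1 <;> cases b <;>
      simp [h1, h1.not_gt, letterWeight, eulerianEval, pow_add] <;> ring_nf

lemma gammaEval_tailWeight_of_ne (b : Bool) (a : ℕ) (l : List ℕ) (h : daTail b a l ≠ 0) :
    gammaEval (tailWeight b a l) = 0 := by
  induction l generalizing b a with
  | nil => cases b <;> simp_all [daTail, tailWeight, letterWeight, gammaEval]
  | cons c l ih =>
    rw [tailWeight, map_mul, map_mul]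
    by_cases h1 : daTail (decide (a < c)) c l = 0
    · have h2 : b = true ∧ a < c := by simpa [daTail, h1] using h
      simp [h2.1, h2.2, letterWeight, gammaEval]
    · rw [ih _ _ h1, mul_zero]

lemma gammaEval_tailWeight (b : Bool) (a : ℕ) (l : List ℕ) (h : (a :: l).Nodup)
    (hda : daTail b a l = 0) :
    ∃ e, e + 2 * (ascW (a :: l) + b.toNat) = l.length + b.toNat ∧
      gammaEval (tailWeight b a l) = (X 0 * X 1) ^ (ascW (a :: l) + b.toNat) * (X 0 + X 1) ^ e
        * X 2 ^ rlminW (a :: l) := by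
  induction l generalizing b a with
  | nil =>
    cases b
    · exact ⟨0, by simp [ascW_singleton], by simp [tailWeight, letterWeight, gammaEval,
        ascW_singleton, rlminW_cons, rlminW_nil]⟩
    · simp [daTail] at hda
  | cons c l ih =>
    have hac : a ≠ c := by rintro rfl; simp at h
    have hr : gammaEval (if ∀ x ∈ c :: l, a < x then X 3 else 1)
        = X 2 ^ (if ∀ x ∈ c :: l, a < x then 1 else 0) := by
      split_ifs <;> simp [gammaEval]
    rw [daTail, Nat.add_eq_zero_iff] at hda
    obtain ⟨e, he, h1⟩ := ih _ _ h.of_cons hda.2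
    rw [tailWeight, map_mul, map_mul, h1, hr, rlminW_cons a, ascW_cons_cons]
    rcases lt_or_gt_of_ne hac with h2 | h2
    · cases b
      · simp only [h2, decide_true, Bool.toNat_true] at he
        refine ⟨e, by simp [h2]; omega, ?_⟩
        simp [h2, letterWeight, pow_add]
        ring_nf
      · simp [h2] at hda
    · simp only [h2.not_gt, decide_false, Bool.toNat_false] at he
      cases b
      · refine ⟨e + 1, by simp [h2.not_gt]; omega, ?_⟩
        simp [h2.not_gt, letterWeight, gammaEval, pow_add]
        ring
      · refine ⟨e, by simp [h2.not_gt]; omega, ?_⟩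
        simp [h2.not_gt, letterWeight, gammaEval, pow_add]
        ring

lemma wordWeight_of_not_isPRW {l : List ℕ} (hnd : l.Nodup) (h0 : ∀ x ∈ l, 1 ≤ x)
    (h : ¬ isPRW l) : wordWeight l = 0 := by
  induction l with
  | nil => rfl
  | cons a l ih =>
    have h1 : a ≠ 1 := by
      rintro rfl
      refine h (isPRW_one_cons fun x hx => lt_of_le_of_ne (h0 x (by simp [hx])) ?_)
      rintro rfl
      simp [hx] at hnd
    cases l with
    | nil => simp [wordWeight, h1]
    | cons c l =>
      rw [wordWeight, if_neg h1]
      split_ifs with h2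
      · rw [ih hnd.of_cons (fun x hx => h0 x (by simp [hx]))
          (fun H => h ((isPRW_cons_cons l h2).2 H)), mul_zero]
      · rfl

lemma eulerianEval_wordWeight {l : List ℕ} (hnd : l.Nodup) (h0 : ∀ x ∈ l, 1 ≤ x) (hl : 1 ∈ l)
    (h : isPRW l) : 1 ≤ lrminW l ∧ eulerianEval (wordWeight l)
      = X 0 ^ desW l * X 1 ^ ascW l * X 2 ^ (lrminW l + rlminW l - 2) := by
  induction l with
  | nil => simp at hl
  | cons a l ih =>
    have h0' : ∀ x ∈ l, 1 ≤ x := fun x hx => h0 x (by simp [hx])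
    by_cases h1 : a = 1
    · subst h1
      rw [lrminW_one_cons h0']
      refine ⟨le_rfl, ?_⟩
      have h3 : ∀ x ∈ l, 1 < x := by
        intro x hx
        refine lt_of_le_of_ne (h0' x hx) ?_
        rintro rfl
        simp [hx] at hnd
      rw [rlminW_cons, if_pos h3]
      cases l with
      | nil => simp [wordWeight, desW_singleton, ascW_singleton, rlminW_nil]
      | cons c l =>
        have hc : 1 < c := h3 c (by simp)
        rw [wordWeight, if_pos rfl, eulerianEval_tailWeight _ _ _ hnd.of_cons, desW_cons_cons,
          ascW_cons_cons, if_pos hc, if_neg hc.not_gt,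
          show 1 + (1 + rlminW (c :: l)) - 2 = rlminW (c :: l) by omega]
        simp only [Bool.toNat_true, zero_add, pow_add]
        ring
    · have hl' : 1 ∈ l := by
        rcases List.mem_cons.1 hl with h2 | h2
        · exact absurd h2.symm h1
        · exact h2
      cases l with
      | nil => simp at hl'
      | cons c l =>
        have hac : a ≠ c := by rintro rfl; simp at hnd
        have hca : c < a := by
          rcases lt_or_gt_of_ne hac with h2 | h2
          · exact absurd h (not_isPRW_cons_cons l h1 h2)
          · exact h2
        obtain ⟨h2, h3⟩ := ih hnd.of_cons h0' hl' ((isPRW_cons_cons l hca).1 h)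
        have hne : ¬ ∀ x ∈ c :: l, a < x := fun H => hca.not_gt (H c (by simp))
        have h4 := one_le_rlminW c l
        rw [lrminW_cons_cons l hca, rlminW_cons a, if_neg hne, desW_cons_cons, ascW_cons_cons,
          if_pos hca, if_neg hca.not_gt, wordWeight, if_neg h1, if_pos hca, map_mul, h3,
          show 1 + lrminW (c :: l) + (0 + rlminW (c :: l)) - 2
            = 1 + (lrminW (c :: l) + rlminW (c :: l) - 2) by omega]
        refine ⟨by omega, ?_⟩
        simp [eulerianEval, pow_add]
        ring

lemma gammaEval_wordWeight_of_ne {a : ℕ} {l : List ℕ} (hnd : (a :: l).Nodup)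
    (h0 : ∀ x ∈ a :: l, 1 ≤ x) (h : daTail false a l ≠ 0) :
    gammaEval (wordWeight (a :: l)) = 0 := by
  induction l generalizing a with
  | nil => simp [daTail] at h
  | cons c l ih =>
    simp only [daTail, Bool.false_and, Bool.toNat_false, zero_add] at h
    rw [wordWeight]
    split_ifs with h1 h2
    · have hac : a ≠ c := by rintro rfl; simp at hnd
      have h3 : a < c := lt_of_le_of_ne (h1 ▸ h0 c (by simp)) hac
      exact gammaEval_tailWeight_of_ne _ _ _ (by simpa [h3] using h)
    · rw [map_mul, ih hnd.of_cons (fun x hx => h0 x (List.mem_cons_of_mem _ hx))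
        (by simpa [h2.not_gt] using h), mul_zero]
    · simp

lemma gammaEval_wordWeight {a : ℕ} {l : List ℕ} (hnd : (a :: l).Nodup)
    (h0 : ∀ x ∈ a :: l, 1 ≤ x) (hl : 1 ∈ a :: l) (h : isPRW (a :: l))
    (hda : daTail false a l = 0) :
    1 ≤ lrminW (a :: l) ∧ ∃ e, e + 2 * ascW (a :: l) = l.length ∧
      gammaEval (wordWeight (a :: l)) = (X 0 * X 1) ^ ascW (a :: l) * (X 0 + X 1) ^ e
        * X 2 ^ (lrminW (a :: l) + rlminW (a :: l) - 2) := by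
  induction l generalizing a with
  | nil =>
    obtain rfl : 1 = a := by simpa using hl
    refine ⟨by simp [lrminW_one_cons], 0, by simp [ascW_singleton], ?_⟩
    simp [wordWeight, ascW_singleton, rlminW_cons, rlminW_nil, lrminW_one_cons]
  | cons c l ih =>
    have h0' : ∀ x ∈ c :: l, 1 ≤ x := fun x hx => h0 x (List.mem_cons_of_mem _ hx)
    have hac : a ≠ c := by rintro rfl; simp at hnd
    simp only [daTail, Bool.false_and, Bool.toNat_false, zero_add] at hda
    by_cases h1 : a = 1
    · subst h1
      have h3 : ∀ x ∈ c :: l, 1 < x := by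
        intro x hx
        refine lt_of_le_of_ne (h0' x hx) ?_
        rintro rfl
        exact (List.nodup_cons.1 hnd).1 hx
      have hc : 1 < c := h3 c (by simp)
      rw [decide_eq_true hc] at hda
      obtain ⟨e, he, h4⟩ := gammaEval_tailWeight _ _ _ hnd.of_cons hda
      rw [lrminW_one_cons h0', rlminW_cons, if_pos h3, wordWeight, if_pos rfl, h4,
        ascW_cons_cons, if_pos hc,
        show 1 + (1 + rlminW (c :: l)) - 2 = rlminW (c :: l) by omega]
      simp only [Bool.toNat_true] at he ⊢
      exact ⟨le_rfl, e, by simp; omega, by rw [add_comm 1]⟩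
    · have hl' : 1 ∈ c :: l := by
        rcases List.mem_cons.1 hl with h2 | h2
        · exact absurd h2.symm h1
        · exact h2
      have hca : c < a := by
        rcases lt_or_gt_of_ne hac with h2 | h2
        · exact absurd h (not_isPRW_cons_cons l h1 h2)
        · exact h2
      rw [decide_eq_false hca.not_gt] at hda
      obtain ⟨h2, e, he, h3⟩ := ih hnd.of_cons h0' hl' ((isPRW_cons_cons l hca).1 h) hda
      have hne : ¬ ∀ x ∈ c :: l, a < x := fun H => hca.not_gt (H c (by simp))
      have h4 := one_le_rlminW c l
      rw [lrminW_cons_cons l hca, rlminW_cons a, if_neg hne, ascW_cons_cons,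
        if_neg hca.not_gt, wordWeight, if_neg h1, if_pos hca, map_mul, h3,
        show 1 + lrminW (c :: l) + (0 + rlminW (c :: l)) - 2
          = 1 + (lrminW (c :: l) + rlminW (c :: l) - 2) by omega]
      refine ⟨by omega, e + 1, by simp; omega, ?_⟩
      simp [gammaEval, pow_add]
      ring

end PRWGamma

open MvPolynomial in
/-- Theorem 2.1(1) of the paper: the `γ`-positivity expansion of the
binomial-Stirling-Eulerian polynomial `Ã_n(x,y|α)` in `ℤ[x,y,α]` (with `x = X 0`,
`y = X 1`, `α = X 2`), where `γ̃_{n,k}(α)` is the generating polynomial of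
`LRmin + RLmin - 2` over permutations in `PRW_{n+1}` with `k` ascents and no double ascents. -/
theorem binomialStirlingEulerian_gamma (n : ℕ) (hn : 1 ≤ n) :
    ∑ σ ∈ PRW (n + 1), (X 0 : MvPolynomial (Fin 3) ℤ) ^ desW (word σ) * X 1 ^ ascW (word σ) *
        X 2 ^ (lrminW (word σ) + rlminW (word σ) - 2)
      = ∑ k ∈ Finset.range (n / 2 + 1),
          (∑ σ ∈ (PRW (n + 1)).filter (fun σ => ascW (word σ) = k ∧ daW (word σ) = 0),
            (X 2 : MvPolynomial (Fin 3) ℤ) ^ (lrminW (word σ) + rlminW (word σ) - 2)) *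
          (X 0 * X 1) ^ k * (X 0 + X 1) ^ (n - 2 * k) := by
  have hmem : ∀ σ : Equiv.Perm (Fin (n + 1)), ∀ x, x ∈ word σ ↔ 1 ≤ x ∧ x ≤ n + 1 := fun σ x => by
    rw [(PRWGamma.word_perm_descList σ).mem_iff, PRWGamma.mem_descList]
  have hnd : ∀ σ : Equiv.Perm (Fin (n + 1)), (word σ).Nodup := fun σ =>
    (PRWGamma.word_perm_descList σ).nodup_iff.2 (PRWGamma.nodup_descList _)
  have hcons : ∀ σ : Equiv.Perm (Fin (n + 1)), ∃ a l, word σ = a :: l ∧ l.length = n ∧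
      daW (word σ) = PRWGamma.daTail false a l := fun σ => by
    have hlen := (PRWGamma.word_perm_descList σ).length_eq
    rw [PRWGamma.length_descList] at hlen
    obtain ⟨a, l, h⟩ := List.exists_cons_of_length_eq_add_one hlen
    have hl : l.length = n := by simpa [h] using hlen
    refine ⟨a, l, h, hl, ?_⟩
    rw [h]
    refine PRWGamma.daW_cons fun x hx => ?_
    rw [← h, hmem] at hx
    omega
  have hgamma : ∀ σ ∈ (PRW (n + 1)).filter (fun σ => daW (word σ) = 0),
      2 * ascW (word σ) ≤ n ∧ PRWGamma.gammaEval (PRWGamma.wordWeight (word σ))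
        = X 2 ^ (lrminW (word σ) + rlminW (word σ) - 2) * (X 0 * X 1) ^ ascW (word σ) *
          (X 0 + X 1) ^ (n - 2 * ascW (word σ)) := fun σ hσ => by
    simp only [PRW, Finset.mem_filter, Finset.mem_univ, true_and] at hσ
    obtain ⟨a, l, h, hl, hda⟩ := hcons σ
    rw [hda] at hσ
    have h0 := hmem σ
    have h1 := hnd σ
    rw [h] at h0 h1 hσ ⊢
    obtain ⟨-, e, he, h2⟩ := PRWGamma.gammaEval_wordWeight h1 (fun x hx => ((h0 x).1 hx).1)
      ((h0 1).2 (by omega)) hσ.1 hσ.2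
    obtain rfl : e = n - 2 * ascW (a :: l) := by omega
    refine ⟨by omega, ?_⟩
    rw [h2]
    ring
  trans PRWGamma.eulerianEval (PRWGamma.totalWeight n)
  · rw [PRWGamma.totalWeight, ← PRWGamma.sum_perm_eq_sum_permutations', map_sum]
    apply Finset.sum_subset_zero_on_sdiff (Finset.subset_univ _)
    · intro σ hσ
      simp only [PRW, Finset.mem_sdiff, Finset.mem_filter, Finset.mem_univ, true_and] at hσ
      rw [PRWGamma.wordWeight_of_not_isPRW (hnd σ) (fun x hx => ((hmem σ x).1 hx).1) hσ, map_zero]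
    · intro σ hσ
      simp only [PRW, Finset.mem_filter, Finset.mem_univ, true_and] at hσ
      exact (PRWGamma.eulerianEval_wordWeight (hnd σ) (fun x hx => ((hmem σ x).1 hx).1)
        ((hmem σ 1).2 (by omega)) hσ).2.symm
  · rw [PRWGamma.eulerianEval_totalWeight, PRWGamma.totalWeight,
      ← PRWGamma.sum_perm_eq_sum_permutations', map_sum]
    symm
    trans ∑ σ ∈ (PRW (n + 1)).filter (fun σ => daW (word σ) = 0),
      PRWGamma.gammaEval (PRWGamma.wordWeight (word σ))
    · rw [← Finset.sum_fiberwise_of_maps_to (t := Finset.range (n / 2 + 1))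
        (g := fun σ => ascW (word σ))
        (fun σ hσ => Finset.mem_range.2 (by have := (hgamma σ hσ).1; omega))]
      refine Finset.sum_congr rfl fun k _ => ?_
      rw [Finset.sum_mul, Finset.sum_mul, Finset.filter_filter]
      refine Finset.sum_congr (Finset.filter_congr fun σ _ => and_comm) fun σ hσ => ?_
      simp only [Finset.mem_filter] at hσ
      rw [(hgamma σ (Finset.mem_filter.2 ⟨hσ.1, hσ.2.1⟩)).2, hσ.2.2]
    · apply Finset.sum_subset (Finset.subset_univ _)
      intro σ _ hσ
      by_cases h : isPRW (word σ)
      · obtain ⟨a, l, h1, hl, hda⟩ := hcons σ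
        have h2 : PRWGamma.daTail false a l ≠ 0 := by
          rw [← hda]
          exact fun h0 => hσ (Finset.mem_filter.2 ⟨Finset.mem_filter.2 ⟨Finset.mem_univ _, h⟩, h0⟩)
        have h3 := hnd σ
        have h0 := hmem σ
        rw [h1] at h3 h0 ⊢
        exact PRWGamma.gammaEval_wordWeight_of_ne h3 (fun x hx => ((h0 x).1 hx).1) h2
      · rw [PRWGamma.wordWeight_of_not_isPRW (hnd σ) (fun x hx => ((hmem σ x).1 hx).1) h, map_zero]
end

section
/- For every n ≥ 1 and every k with 0 ≤ 2k ≤ n, one has ∑_{σ∈PRW_{n+1}, M(σ)=k} α^{LRmin(σ)+RLmin(σ)−2} = 2^{n−2k} · ∑_{σ∈PRW_{n+1}, asc(σ)=k, da(σ)=0} α^{LRmin(σ)+RLmin(σ)−2} as an identity of polynomials in ℤ[α]. -/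
/-- The weight of the letters `l` read after the letter `a`: a double ascent contributes `y`,
a double descent `z`, a peak `t`, and each right-to-left minimum contributes `α`. The last letter
is followed by `+∞`. -/
def tailWeight {R : Type*} [CommRing R] (α y z t : R) : ℕ → List ℕ → R
  | _, [] => 1
  | a, [b] => α * (if a < b then y else 1)
  | a, b :: c :: l =>
    (if ∀ d ∈ c :: l, b < d then α else 1) *
      (if a < b then (if b < c then y else t) else (if b < c then 1 else z)) *
      tailWeight α y z t b (c :: l)

/-- The weight of a word whose letters decrease until the letter `1`: each letter before `1`
contributes `α * u` and the rest is weighted by `tailWeight`. Other words have weight `0`. -/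
def prwWeight {R : Type*} [CommRing R] (α y z u t : R) : List ℕ → R
  | [] => 0
  | [x] => if x = 1 then 1 else 0
  | x :: b :: l =>
    if x = 1 then tailWeight α y z t 1 (b :: l)
    else if b < x then α * u * prwWeight α y z u t (b :: l) else 0

theorem tailWeight_map {R S : Type*} [CommRing R] [CommRing S] (f : R →+* S) (α y z t : R)
    (l : List ℕ) : ∀ a, f (tailWeight α y z t a l) = tailWeight (f α) (f y) (f z) (f t) a l := by
  induction l with
  | nil => intro a; simp [tailWeight]
  | cons b l ih =>
    intro a
    cases l with
    | nil => simp only [tailWeight]; split_ifs <;> simp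
    | cons c l => simp only [tailWeight, map_mul, ih]; split_ifs <;> simp

theorem prwWeight_map {R S : Type*} [CommRing R] [CommRing S] (f : R →+* S) (α y z u t : R)
    (l : List ℕ) : f (prwWeight α y z u t l) = prwWeight (f α) (f y) (f z) (f u) (f t) l := by
  induction l with
  | nil => simp [prwWeight]
  | cons b l ih =>
    cases l with
    | nil => simp only [prwWeight]; split_ifs <;> simp
    | cons c l => simp only [prwWeight]; split_ifs <;> simp [tailWeight_map, ih]

theorem perm_of_mem_permutations'Aux {β : Type*} (x : β) (l : List β) :
    ∀ m ∈ List.permutations'Aux x l, m.Perm (x :: l) := by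
  induction l with
  | nil => simp
  | cons y l ih =>
    intro m hm
    simp only [List.permutations'Aux, List.mem_cons, List.mem_map] at hm
    rcases hm with rfl | ⟨m', hm', rfl⟩
    · rfl
    · exact ((ih m' hm').cons y).trans (List.Perm.swap x y l)

section insertion

variable {A B : Type*} [CommRing A] [CommRing B] [Algebra A B] (D : Derivation A B B)
  {α y z u t : B}

theorem sum_tailWeight_insert (hα : D α = 0) (hy : D y = t) (hz : D z = t)
    (ht : D t = (y + z) * t) {M : ℕ} (l : List ℕ) :
    ∀ a b, a < M → b < M → (∀ c ∈ l, c < M) →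
      ((l.permutations'Aux M).map (fun l' => tailWeight α y z t a (b :: l'))).sum
        + (if a < b then tailWeight α y z t a (M :: b :: l) else 0)
      = α * y * tailWeight α y z t a (b :: l) + D (tailWeight α y z t a (b :: l)) := by
  induction l with
  | nil =>
    intro a b ha hb _
    have h1 : ¬ M < b := by omega
    by_cases hab : a < b
    · simp [tailWeight, hab, hb, h1, ha, hα, hy, Derivation.leibniz]; ring
    · simp [tailWeight, hab, hb, hα]; ring
  | cons c l ih =>
    intro a b ha hb hl
    have hc : c < M := hl c (by simp)
    have hl' : ∀ d ∈ l, d < M := fun d hd => hl d (by simp [hd])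
    have hMc : ¬ M < c := by omega
    have hMb : ¬ M < b := by omega
    have IH := ih b c hb hc hl'
    have hsum : (((l.permutations'Aux M).map (fun l' => tailWeight α y z t a (b :: c :: l'))).sum)
        = ((if ∀ d ∈ c :: l, b < d then α else 1) *
          (if a < b then (if b < c then y else t) else (if b < c then 1 else z))) *
          ((l.permutations'Aux M).map (fun l' => tailWeight α y z t b (c :: l'))).sum := by
      rw [← List.sum_map_mul_left]
      congr 1
      apply List.map_congr_left
      intro m hm
      have hp := perm_of_mem_permutations'Aux M l m hm
      have : (∀ d ∈ c :: m, b < d) ↔ (∀ d ∈ c :: l, b < d) := by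
        simp only [List.mem_cons, hp.mem_iff]
        constructor
        · rintro h d (rfl | h') <;> apply h <;> simp_all
        · rintro h d (rfl | rfl | h')
          · apply h; simp
          · exact hb
          · apply h; simp [h']
      simp only [tailWeight, this]
    simp only [List.permutations'Aux, List.map_cons, List.map_map, List.sum_cons, Function.comp_def]
    rw [hsum]
    have hρ : (∀ d ∈ M :: c :: l, b < d) ↔ (∀ d ∈ c :: l, b < d) := by
      simp [hb]
    have hM1 : ∀ b', ¬ (∀ d ∈ b' :: c :: l, M < d) := fun b' h => by
      have := h c (by simp); omega
    have e1 : tailWeight α y z t a (b :: M :: c :: l) = (if ∀ d ∈ c :: l, b < d then α else 1) *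
        (if a < b then y else 1) * tailWeight α y z t b (M :: c :: l) := by
      rw [tailWeight]; simp only [hρ, hb, if_true]
    have e2 : tailWeight α y z t a (M :: b :: c :: l) = t * tailWeight α y z t M (b :: c :: l) := by
      rw [tailWeight]; rw [if_neg (hM1 b)]; simp only [ha, hMb, if_true, if_false, one_mul]
    have e3 : tailWeight α y z t M (b :: c :: l) = (if ∀ d ∈ c :: l, b < d then α else 1) *
        (if b < c then 1 else z) * tailWeight α y z t b (c :: l) := by
      rw [tailWeight]; simp only [hMb, if_false]
    have e4 : tailWeight α y z t a (b :: c :: l) = (if ∀ d ∈ c :: l, b < d then α else 1) *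
        (if a < b then (if b < c then y else t) else (if b < c then 1 else z)) *
        tailWeight α y z t b (c :: l) := by
      rw [tailWeight]
    have e5 : ¬ b < c → tailWeight α y z t b (M :: c :: l) = t * tailWeight α y z t b (c :: l) := by
      intro h
      have : tailWeight α y z t M (c :: l) = tailWeight α y z t b (c :: l) := by
        cases l <;> simp only [tailWeight, h, hMc, if_false]
      rw [← this, tailWeight]
      rw [if_neg (fun h' => by have := h' c (by simp); omega)]
      simp only [hb, hMc, if_true, if_false, one_mul]
    have hDρ : D (if ∀ d ∈ c :: l, b < d then α else 1) = 0 := by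
      split_ifs <;> simp [hα]
    rw [e1, e2, e3, e4]
    set g := tailWeight α y z t b (c :: l)
    set ρ := (if ∀ d ∈ c :: l, b < d then α else 1) with hρdef
    by_cases hbc : b < c
    · simp only [hbc, if_true] at IH ⊢
      by_cases hab : a < b
      · simp only [hab, if_true, Derivation.leibniz, hDρ, smul_eq_mul, hy]
        linear_combination ρ * y * IH
      · simp only [hab, if_false, Derivation.leibniz, hDρ, smul_eq_mul, Derivation.map_one_eq_zero]
        linear_combination ρ * IH
    · have hρ1 : ρ = 1 := by rw [hρdef, if_neg (fun h => hbc (h c (by simp)))]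
      simp only [hbc, if_false, add_zero] at IH ⊢
      rw [e5 hbc, hρ1, IH]
      by_cases hab : a < b
      · simp only [hab, if_true, Derivation.leibniz, smul_eq_mul, ht, Derivation.map_one_eq_zero]
        ring
      · simp only [hab, if_false, Derivation.leibniz, smul_eq_mul, hz, Derivation.map_one_eq_zero]
        ring

theorem sum_prwWeight_cons_insert (hα : D α = 0) (hy : D y = t) (hz : D z = t) (hu : D u = 0)
    (ht : D t = (y + z) * t) {M : ℕ} (hM : 1 < M) (l : List ℕ) :
    ∀ x, x < M → (∀ c ∈ l, c < M) →
      (∀ c ∈ l, 0 < c) → (x :: l).Nodup →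
      ((l.permutations'Aux M).map (fun l' => prwWeight α y z u t (x :: l'))).sum
      = α * y * prwWeight α y z u t (x :: l) + D (prwWeight α y z u t (x :: l)) := by
  induction l with
  | nil =>
    intro x hx _ _ _
    have : ¬ M < x := by omega
    by_cases h : x = 1 <;> simp [prwWeight, tailWeight, h, this, hM]
  | cons b l ih =>
    intro x hx hl hpos hnd
    have hb : b < M := hl b (by simp)
    have hb0 : 0 < b := hpos b (by simp)
    have hl' : ∀ d ∈ l, d < M := fun d hd => hl d (by simp [hd])
    have IH := ih b hb hl' (fun d hd => hpos d (by simp [hd])) (List.nodup_cons.1 hnd).2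
    have hMx : ¬ M < x := by omega
    simp only [List.permutations'Aux, List.map_cons, List.map_map, List.sum_cons, Function.comp_def]
    by_cases h : x = 1
    · subst h
      have hb1 : 1 < b := by
        have : b ≠ 1 := fun h => by simp [h] at hnd
        omega
      simp only [prwWeight, if_true]
      rw [← sum_tailWeight_insert D hα hy hz ht l 1 b hM hb hl']
      simp only [hb1, if_true]
      ring
    · simp only [prwWeight, h, if_false, hMx, zero_add]
      by_cases hbx : b < x
      · simp only [hbx, if_true, List.sum_map_mul_left, IH, Derivation.leibniz, hα, hu, smul_eq_mul]
        ring
      · simp [hbx]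

theorem sum_prwWeight_insert (hα : D α = 0) (hy : D y = t) (hz : D z = t) (hu : D u = 0)
    (ht : D t = (y + z) * t) {M : ℕ} (hM : 1 < M) {w : List ℕ} (hw : w ≠ [])
    (hlt : ∀ c ∈ w, c < M) (hpos : ∀ c ∈ w, 0 < c) (hnd : w.Nodup) :
    ((w.permutations'Aux M).map (prwWeight α y z u t)).sum
      = α * (u + y) * prwWeight α y z u t w + D (prwWeight α y z u t w) := by
  cases w with
  | nil => exact absurd rfl hw
  | cons x l =>
    have hx := hlt x (by simp)
    have := sum_prwWeight_cons_insert D hα hy hz hu ht hM l x hx (fun c hc => hlt c (by simp [hc]))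
      (fun c hc => hpos c (by simp [hc])) hnd
    simp only [List.permutations'Aux, List.map_cons, List.map_map, List.sum_cons, Function.comp_def]
    rw [this]
    have hM1 : M ≠ 1 := by omega
    simp only [prwWeight, hM1, if_false, hx, if_true]
    ring

end insertion

/-- The one-line word `m ⋯ 2 1`. -/
def descList : ℕ → List ℕ
  | 0 => []
  | m + 1 => (m + 1) :: descList m

theorem mem_descList {m x : ℕ} : x ∈ descList m ↔ 0 < x ∧ x ≤ m := by
  induction m with
  | zero => simp [descList]; omega
  | succ m ih => simp only [descList, List.mem_cons, ih]; omega

theorem nodup_descList (m : ℕ) : (descList m).Nodup := by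
  induction m with
  | zero => simp [descList]
  | succ m ih => simp [descList, ih, mem_descList]

theorem length_descList (m : ℕ) : (descList m).length = m := by
  induction m with
  | zero => simp [descList]
  | succ m ih => simp [descList, ih]

theorem word_perm_descList {m : ℕ} (σ : Equiv.Perm (Fin m)) : (word σ).Perm (descList m) := by
  rw [List.perm_ext_iff_of_nodup _ (nodup_descList m)]
  · intro x
    simp only [word, List.mem_ofFn, mem_descList]
    constructor
    · rintro ⟨i, rfl⟩
      have := (σ i).2
      omega
    · rintro ⟨h0, h1⟩
      exact ⟨σ.symm ⟨x - 1, by omega⟩, by simp; omega⟩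
  · rw [word, List.nodup_ofFn]
    intro i j h
    apply σ.injective
    apply Fin.ext
    simpa using h

theorem word_injective {m : ℕ} : Function.Injective (word : Equiv.Perm (Fin m) → List ℕ) := by
  intro σ τ h
  have := List.ofFn_injective h
  ext i
  simpa using congrFun this i

theorem sum_word {R : Type*} [CommRing R] (F : List ℕ → R) (m : ℕ) :
    ∑ σ : Equiv.Perm (Fin m), F (word σ) = ((descList m).permutations'.map F).sum := by
  have hp := List.permutations_perm_permutations' (descList m)
  rw [← (hp.map F).sum_eq,
    ← List.sum_toFinset _ (List.nodup_permutations _ (nodup_descList m)),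
    ← Finset.sum_image (f := F) (fun σ _ τ _ h => word_injective h)]
  refine Finset.sum_congr (Finset.eq_of_subset_of_card_le ?_ ?_) (fun _ _ => rfl)
  · intro w hw
    obtain ⟨σ, -, rfl⟩ := Finset.mem_image.1 hw
    simpa using word_perm_descList σ
  · rw [Finset.card_image_of_injective _ word_injective,
      List.toFinset_card_of_nodup (List.nodup_permutations _ (nodup_descList m)),
      List.length_permutations, length_descList, Finset.card_univ, Fintype.card_perm,
      Fintype.card_fin]

theorem sum_prwWeight_succ {A B : Type*} [CommRing A] [CommRing B] [Algebra A B]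
    (D : Derivation A B B) {α y z u t : B} (hα : D α = 0) (hy : D y = t) (hz : D z = t)
    (hu : D u = 0) (ht : D t = (y + z) * t) (m : ℕ) :
    ((descList (m + 2)).permutations'.map (prwWeight α y z u t)).sum =
      α * (u + y) * ((descList (m + 1)).permutations'.map (prwWeight α y z u t)).sum +
        D ((descList (m + 1)).permutations'.map (prwWeight α y z u t)).sum := by
  rw [descList, List.permutations', List.map_flatMap, List.flatMap_def, List.sum_flatten,
    List.map_map, map_list_sum, ← List.sum_map_mul_left, List.map_map, ← List.sum_map_add]
  congr 1
  apply List.map_congr_left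
  intro w hw
  have hw := List.mem_permutations'.1 hw
  have hmem : ∀ c ∈ w, 0 < c ∧ c ≤ m + 1 := fun c hc => mem_descList.1 (hw.mem_iff.1 hc)
  refine sum_prwWeight_insert D hα hy hz hu ht (by omega) ?_ ?_ ?_ ?_
  · rintro rfl
    simp [descList] at hw
  · intro c hc
    have := hmem c hc
    omega
  · exact fun c hc => (hmem c hc).1
  · exact hw.nodup_iff.2 (nodup_descList _)

open MvPolynomial in
theorem sum_prwWeight_shift {A : Type*} [CommRing A] (a t : A) (n : ℕ) :
    ((descList (n + 1)).permutations'.map (prwWeight a 1 1 1 (4 * t))).sum =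
      2 ^ n * ((descList (n + 1)).permutations'.map (prwWeight a 0 1 1 t)).sum := by
  let D : Derivation A (MvPolynomial (Fin 4) A) (MvPolynomial (Fin 4) A) :=
    mkDerivation A ![X 3, X 3, 0, (X 0 + X 1) * X 3]
  let θ : MvPolynomial (Fin 4) A →ₐ[A] MvPolynomial (Fin 4) A :=
    aeval ![2 * X 0 + 1, 2 * X 1 - 1, 2 * X 2 - 1, 4 * X 3]
  let P : ℕ → MvPolynomial (Fin 4) A := fun m =>
    ((descList (m + 1)).permutations'.map
      (prwWeight (C a : MvPolynomial (Fin 4) A) (X 0) (X 1) (X 2) (X 3))).sum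
  have hDC (n : ℕ) : D (n : MvPolynomial (Fin 4) A) = 0 := D.map_natCast n
  have hD2 : D 2 = 0 := hDC 2
  have hD4 : D 4 = 0 := hDC 4
  have hDX (i : Fin 4) : D (X i) = ![X 3, X 3, 0, (X 0 + X 1) * X 3] i := mkDerivation_X _ _ _
  have hθX (i : Fin 4) :
      θ (X i) = ![2 * X 0 + 1, 2 * X 1 - 1, 2 * X 2 - 1, 4 * X 3] i := aeval_X _ _
  have hcomm (p : MvPolynomial (Fin 4) A) : θ (D p) = 2 * D (θ p) := by
    induction p using MvPolynomial.induction_on with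
    | C c =>
      have h1 : D (C c) = 0 := D.map_algebraMap c
      have h2 : θ (C c) = C c := θ.commutes c
      simp [h1, h2]
    | add p q hp hq => simp only [map_add, hp, hq]; ring
    | mul_X p i hp =>
      rw [Derivation.leibniz, map_add, smul_eq_mul, smul_eq_mul, map_mul, map_mul, map_mul, hp,
        Derivation.leibniz, smul_eq_mul, smul_eq_mul]
      have : θ (D (X i)) = 2 * D (θ (X i)) := by
        fin_cases i <;> simp [hDX, hθX, Derivation.leibniz, hD2, hD4] <;> ring
      rw [this]
      ring
  have hsucc (m : ℕ) : P (m + 1) = C a * (X 2 + X 0) * P m + D (P m) :=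
    sum_prwWeight_succ D (D.map_algebraMap a) (by simp [hDX]) (by simp [hDX]) (by simp [hDX])
      (by simp [hDX]) m
  have hP (m : ℕ) : θ (P m) = 2 ^ m * P m := by
    induction m with
    | zero => simp [P, descList, prwWeight]
    | succ m ih =>
      have h2 : θ (C a) = C a := θ.commutes a
      have h3 : D (2 ^ m * P m) = 2 ^ m * D (P m) := by
        have := hDC (2 ^ m)
        push_cast at this
        simp [Derivation.leibniz, this]
      rw [hsucc, map_add, hcomm, map_mul, map_mul, map_add, h2, ih, h3, hθX, hθX]
      simp only [Matrix.cons_val]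
      ring
  have key := congrArg (aeval ![(0 : A), 1, 1, t]) (hP n)
  have hcomp : ∀ p, aeval ![(0 : A), 1, 1, t] (θ p) = aeval ![(1 : A), 1, 1, 4 * t] p := by
    intro p
    rw [← AlgHom.comp_apply]
    congr 1
    ext i
    fin_cases i <;> simp [hθX] <;> norm_num
  have hev (v : Fin 4 → A) : aeval v (P n) =
      ((descList (n + 1)).permutations'.map (prwWeight a (v 0) (v 1) (v 2) (v 3))).sum := by
    rw [map_list_sum, List.map_map]
    congr 1
    apply List.map_congr_left
    intro w _
    have := prwWeight_map (aeval v : MvPolynomial (Fin 4) A →ₐ[A] A).toRingHom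
      (C a) (X 0) (X 1) (X 2) (X 3) w
    simpa using this
  rw [hcomp, map_mul, map_pow, hev, hev] at key
  simpa using key

theorem card_filter_Icc_one (P : ℕ → Prop) [DecidablePred P] (n : ℕ) :
    ((Finset.Icc 1 n).filter P).card = ∑ i ∈ Finset.range n, if P (i + 1) then 1 else 0 := by
  rw [Finset.card_filter, Finset.range_eq_Ico,
    Finset.sum_Ico_add' (fun i => if P i then 1 else 0) 0 n 1]
  rfl

/-- The number of letters of a word satisfying `P` together with both of their neighbours, where
the first letter is preceded by the given letter and the last one is followed by `r`. -/
def tripleCount (P : ℕ → ℕ → ℕ → Prop) [∀ a b c, Decidable (P a b c)] (r : ℕ) :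
    ℕ → List ℕ → ℕ
  | _, [] => 0
  | a, b :: l => (if P a b (l.headD r) then 1 else 0) + tripleCount P r b l

theorem sum_triple_eq_tripleCount (P : ℕ → ℕ → ℕ → Prop) [∀ a b c, Decidable (P a b c)] (r : ℕ)
    (w : List ℕ) : ∀ (a : ℕ) (f : ℕ → ℕ),
      (∀ i ≤ w.length + 1, f i = (a :: (w ++ [r])).getD i 0) →
      (∑ i ∈ Finset.range w.length, if P (f i) (f (i + 1)) (f (i + 2)) then 1 else 0)
        = tripleCount P r a w := by
  induction w with
  | nil => intro a f _; simp [tripleCount]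
  | cons b l ih =>
    intro a f hf
    have h0 : f 0 = a := by simpa using hf 0 (by simp)
    have h1 : f 1 = b := by simpa using hf 1 (by simp)
    have h2 : f 2 = l.headD r := by
      have := hf 2 (by simp)
      cases l <;> simpa using this
    have IH := ih b (fun i => f (i + 1)) (by
      intro i hi
      have := hf (i + 1) (by simpa using hi)
      simpa using this)
    rw [List.length_cons, Finset.sum_range_succ', tripleCount, ← IH, add_comm]
    simp only [h0, h1, h2, zero_add]

theorem wB_eq_getD (w : List ℕ) : ∀ i ≤ w.length + 1,
    wB w i = ((w.length + 1) :: (w ++ [w.length + 1])).getD i 0 := by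
  intro i hi
  cases i with
  | zero => simp [wB]
  | succ i =>
    rcases Nat.lt_or_ge i w.length with h | h
    · have : i + 1 ≤ w.length := h
      simp [wB, this, List.getElem?_append_left h]
    · obtain rfl : i = w.length := by omega
      simp [wB]

theorem daW_eq_tripleCount (w : List ℕ) :
    daW w = tripleCount (fun a b c => a < b ∧ b < c) (w.length + 1) (w.length + 1) w := by
  rw [daW, card_filter_Icc_one, ← sum_triple_eq_tripleCount _ _ _ _ _ (wB_eq_getD w)]
  rfl

theorem pkW_eq_tripleCount (w : List ℕ) :
    pkW w = tripleCount (fun a b c => a < b ∧ c < b) (w.length + 1) (w.length + 1) w := by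
  rw [pkW, card_filter_Icc_one, ← sum_triple_eq_tripleCount _ _ _ _ _ (wB_eq_getD w)]
  rfl

theorem wB_cons_one (x : ℕ) (l : List ℕ) : wB (x :: l) 1 = x := by
  simp [wB]

theorem wB_cons_succ (x : ℕ) (l : List ℕ) {i : ℕ} (h1 : 1 ≤ i) (h2 : i ≤ l.length) :
    wB (x :: l) (i + 1) = wB l i := by
  obtain ⟨j, rfl⟩ : ∃ j, i = j + 1 := ⟨i - 1, by omega⟩
  have h3 : j < l.length := h2
  simp [wB, h2, List.getElem?_eq_getElem h3]

theorem wB_mem {w : List ℕ} {i : ℕ} (h1 : 1 ≤ i) (h2 : i ≤ w.length) : wB w i ∈ w := by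
  have h : i - 1 < w.length := by omega
  simp [wB, h1, h2, List.getElem?_eq_getElem h]

theorem exists_wB_of_mem {w : List ℕ} {x : ℕ} (hx : x ∈ w) :
    ∃ i, 1 ≤ i ∧ i ≤ w.length ∧ wB w i = x := by
  obtain ⟨i, hi, rfl⟩ := List.getElem_of_mem hx
  refine ⟨i + 1, by omega, hi, ?_⟩
  have : i + 1 ≤ w.length := hi
  simp [wB, this, List.getElem?_eq_getElem hi]

theorem wB_ne_wB_succ {w : List ℕ} (hnd : w.Nodup) (hlt : ∀ x ∈ w, x ≤ w.length) {i : ℕ}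
    (h1 : 1 ≤ i) (h2 : i ≤ w.length) : wB w i ≠ wB w (i + 1) := by
  rcases Nat.lt_or_ge i w.length with h | h
  · obtain ⟨j, rfl⟩ : ∃ j, i = j + 1 := ⟨i - 1, by omega⟩
    have hj : j < w.length := by omega
    have h3 : j + 1 + 1 ≤ w.length := h
    simp only [wB, h1, h2, h3, Nat.le_add_left, and_self, if_true, Nat.add_sub_cancel,
      List.getD_eq_getElem?_getD, List.getElem?_eq_getElem hj, List.getElem?_eq_getElem h,
      Option.getD_some]
    intro he
    have := (hnd.getElem_inj_iff).1 he
    omega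
  · have h3 := hlt _ (wB_mem h1 h2)
    have : wB w (i + 1) = w.length + 1 := by simp [wB]; omega
    omega

theorem ascW_eq_daW_add_pkW {w : List ℕ} (hnd : w.Nodup) (hlt : ∀ x ∈ w, x ≤ w.length)
    (hw : w ≠ []) : ascW w = daW w + pkW w := by
  obtain ⟨n, hn⟩ : ∃ n, w.length = n + 1 :=
    ⟨w.length - 1, by have := List.length_pos_iff.2 hw; omega⟩
  rw [ascW, daW, pkW, card_filter_Icc_one, card_filter_Icc_one, card_filter_Icc_one,
    ← Finset.sum_add_distrib, hn, Nat.add_sub_cancel, Finset.sum_range_succ']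
  have h0 : ¬ wB w 0 < wB w 1 := by
    have h1 := hlt _ (wB_mem (i := 1) le_rfl (by omega))
    have : wB w 0 = w.length + 1 := by simp [wB]
    omega
  simp only [isDAat, isPkat, zero_add, Nat.sub_self, h0, false_and, if_false, add_zero]
  refine Finset.sum_congr rfl fun i hi => ?_
  have hi := Finset.mem_range.1 hi
  have := wB_ne_wB_succ hnd hlt (i := i + 1 + 1) (by omega) (by omega)
  simp only [Nat.add_sub_cancel]
  split_ifs <;> omega

theorem forall_wB_iff {l : List ℕ} {p : ℕ → Prop} :
    (∀ j ∈ Finset.Icc 1 l.length, p (wB l j)) ↔ ∀ d ∈ l, p d := by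
  constructor
  · intro h d hd
    obtain ⟨i, h1, h2, rfl⟩ := exists_wB_of_mem hd
    exact h i (Finset.mem_Icc.2 ⟨h1, h2⟩)
  · intro h j hj
    have := Finset.mem_Icc.1 hj
    exact h _ (wB_mem this.1 this.2)

theorem rlminW_cons (x : ℕ) (l : List ℕ) :
    rlminW (x :: l) = (if ∀ d ∈ l, x < d then 1 else 0) + rlminW l := by
  rw [rlminW, rlminW, card_filter_Icc_one, card_filter_Icc_one]
  refine (Finset.sum_range_succ' _ l.length).trans ((add_comm _ _).trans ?_)
  congr 1
  · have : isRLat (x :: l) (0 + 1) ↔ ∀ d ∈ l, x < d := by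
      rw [← forall_wB_iff, isRLat, wB_cons_one, List.length_cons]
      constructor
      · intro h j hj
        have hj := Finset.mem_Icc.1 hj
        have := h (j + 1) (Finset.mem_Icc.2 (by omega))
        rwa [wB_cons_succ x l hj.1 hj.2] at this
      · intro h j hj
        have hj := Finset.mem_Icc.1 hj
        obtain ⟨k, rfl⟩ : ∃ k, j = k + 1 := ⟨j - 1, by omega⟩
        rw [wB_cons_succ x l (by omega) (by omega)]
        exact h k (Finset.mem_Icc.2 (by omega))
    simp only [this]
  · refine Finset.sum_congr rfl fun i hi => ?_
    have hi := Finset.mem_range.1 hi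
    have : isRLat (x :: l) (i + 1 + 1) ↔ isRLat l (i + 1) := by
      rw [isRLat, isRLat, wB_cons_succ x l (by omega) (by omega), List.length_cons]
      constructor
      · intro h j hj
        have hj := Finset.mem_Icc.1 hj
        have := h (j + 1) (Finset.mem_Icc.2 (by omega))
        rwa [wB_cons_succ x l (by omega) hj.2] at this
      · intro h j hj
        have hj := Finset.mem_Icc.1 hj
        obtain ⟨k, rfl⟩ : ∃ k, j = k + 1 := ⟨j - 1, by omega⟩
        rw [wB_cons_succ x l (by omega) (by omega)]
        exact h k (Finset.mem_Icc.2 (by omega))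
    simp only [this]

theorem isLRat_cons_succ (x : ℕ) (l : List ℕ) {i : ℕ} (h1 : 1 ≤ i) (h2 : i ≤ l.length) :
    isLRat (x :: l) (i + 1) ↔ wB l i < x ∧ isLRat l i := by
  rw [isLRat, isLRat, wB_cons_succ x l h1 h2, Nat.add_sub_cancel]
  constructor
  · intro h
    refine ⟨?_, fun j hj => ?_⟩
    · have := h 1 (Finset.mem_Icc.2 ⟨le_rfl, h1⟩)
      rwa [wB_cons_one] at this
    · have hj := Finset.mem_Icc.1 hj
      have := h (j + 1) (Finset.mem_Icc.2 (by omega))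
      rwa [wB_cons_succ x l (by omega) (by omega)] at this
  · rintro ⟨h, h'⟩ j hj
    have hj := Finset.mem_Icc.1 hj
    obtain ⟨k, rfl⟩ : ∃ k, j = k + 1 := ⟨j - 1, by omega⟩
    rcases Nat.eq_zero_or_pos k with rfl | hk
    · rwa [zero_add, wB_cons_one]
    · rw [wB_cons_succ x l hk (by omega)]
      exact h' k (Finset.mem_Icc.2 (by omega))

theorem lrminW_cons (x : ℕ) (l : List ℕ) :
    lrminW (x :: l) = 1 + ∑ i ∈ Finset.range l.length,
      if wB l (i + 1) < x ∧ isLRat l (i + 1) then 1 else 0 := by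
  rw [lrminW, card_filter_Icc_one]
  refine (Finset.sum_range_succ' _ l.length).trans ((add_comm _ _).trans ?_)
  congr 1
  refine Finset.sum_congr rfl fun i hi => ?_
  have hi := Finset.mem_range.1 hi
  simp only [isLRat_cons_succ x l (Nat.le_add_left 1 i) hi]

theorem lrminW_cons_of_forall_lt {x : ℕ} {l : List ℕ} (h : ∀ d ∈ l, x < d) :
    lrminW (x :: l) = 1 := by
  rw [lrminW_cons, Finset.sum_eq_zero, add_zero]
  intro i hi
  have hi := Finset.mem_range.1 hi
  have := h _ (wB_mem (w := l) (i := i + 1) (by omega) hi)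
  rw [if_neg]
  omega

theorem lrminW_cons_cons_of_lt {x y : ℕ} (l : List ℕ) (h : y < x) :
    lrminW (x :: y :: l) = 1 + lrminW (y :: l) := by
  rw [lrminW_cons, lrminW, card_filter_Icc_one]
  congr 1
  refine Finset.sum_congr rfl fun i hi => ?_
  have : isLRat (y :: l) (i + 1) → wB (y :: l) (i + 1) < x := by
    intro hLR
    rcases Nat.eq_zero_or_pos i with rfl | hi0
    · rwa [zero_add, wB_cons_one]
    · have := hLR 1 (Finset.mem_Icc.2 (by omega))
      rw [wB_cons_one] at this
      omega
  simp only [and_iff_right_of_imp this]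

theorem isPRW_one_cons {l : List ℕ} (h : ∀ d ∈ l, 1 < d) : isPRW (1 :: l) := by
  intro i hi _ hfirst
  have hi := Finset.mem_Icc.1 hi
  rw [List.length_cons] at hi
  rcases Nat.lt_or_ge 1 i with h1 | h1
  · exfalso
    apply hfirst 1 (Finset.mem_Icc.2 (by omega))
    rw [wB_cons_one, wB_cons_succ 1 l le_rfl (by omega)]
    exact h _ (wB_mem le_rfl (by omega))
  · obtain rfl : i = 1 := by omega
    exact wB_cons_one 1 l

theorem not_isPRW_cons_cons {x y : ℕ} (l : List ℕ) (hx : x ≠ 1) (h : x < y) :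
    ¬ isPRW (x :: y :: l) := by
  intro hP
  apply hx
  have := hP 1 (by simp) (by
    rw [wB_cons_one, wB_cons_succ x (y :: l) le_rfl (by simp), wB_cons_one]
    exact h) (by simp)
  rwa [wB_cons_one] at this

theorem isPRW_cons_cons_of_lt {x y : ℕ} (l : List ℕ) (h : y < x) :
    isPRW (x :: y :: l) ↔ isPRW (y :: l) := by
  have h1 : ¬ wB (x :: y :: l) 1 < wB (x :: y :: l) 2 := by
    rw [wB_cons_one, wB_cons_succ x (y :: l) le_rfl (by simp), wB_cons_one]
    omega
  have hs : ∀ i, 1 ≤ i → i ≤ l.length + 1 → wB (x :: y :: l) (i + 1) = wB (y :: l) i :=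
    fun i h1 h2 => wB_cons_succ x (y :: l) h1 h2
  simp only [isPRW, List.length_cons, Nat.add_sub_cancel, Finset.mem_Icc]
  constructor
  · intro H i hi hlt hfirst
    rw [← hs i hi.1 (by omega)]
    apply H (i + 1) (by omega)
    · rwa [hs i (by omega) (by omega), hs (i + 1) (by omega) (by omega)]
    · intro j hj
      obtain ⟨k, rfl⟩ : ∃ k, j = k + 1 := ⟨j - 1, by omega⟩
      rcases Nat.eq_zero_or_pos k with rfl | hk
      · exact h1
      · rw [hs k hk (by omega), hs (k + 1) (by omega) (by omega)]
        exact hfirst k (by omega)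
  · intro H i hi hlt hfirst
    obtain ⟨k, rfl⟩ : ∃ k, i = k + 1 := ⟨i - 1, by omega⟩
    rcases Nat.eq_zero_or_pos k with rfl | hk
    · exact absurd hlt h1
    · rw [hs k hk (by omega)]
      rw [hs k hk (by omega), hs (k + 1) (by omega) (by omega)] at hlt
      apply H k (by omega) hlt
      intro j hj
      have := hfirst (j + 1) (by omega)
      rwa [hs j (by omega) (by omega), hs (j + 1) (by omega) (by omega)] at this

theorem tailWeight_eq {R : Type*} [CommRing R] (α y t : R) (r : ℕ) (l : List ℕ) :
    ∀ a, l.Nodup → (∀ c ∈ l, c < r) →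
      tailWeight α y 1 t a l = α ^ rlminW l *
        t ^ tripleCount (fun a b c => a < b ∧ c < b) r a l *
        y ^ tripleCount (fun a b c => a < b ∧ b < c) r a l := by
  induction l with
  | nil => intro a _ _; simp [tailWeight, tripleCount, rlminW]
  | cons b l ih =>
    intro a hnd hlt
    cases l with
    | nil =>
      have h1 : b < r := hlt b (by simp)
      have h2 : ¬ r < b := by omega
      have h3 : rlminW [b] = 1 := by rw [rlminW_cons]; simp [rlminW]
      simp only [tailWeight, tripleCount, h3, List.headD_nil, h1, h2]
      by_cases hab : a < b <;> simp [hab]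
    | cons c l =>
      have hbc : b ≠ c := fun h => by simp [h] at hnd
      rw [tailWeight, ih b (List.nodup_cons.1 hnd).2 (fun d hd => hlt d (by simp [hd])),
        rlminW_cons b, tripleCount.eq_2 _ _ a, tripleCount.eq_2 _ _ a, pow_add, pow_add, pow_add,
        List.headD_cons]
      have e1 : (if ∀ d ∈ c :: l, b < d then α else 1) =
          α ^ (if ∀ d ∈ c :: l, b < d then 1 else 0) := by split_ifs <;> simp
      have e2 : (if a < b then (if b < c then y else t) else (if b < c then 1 else 1)) =
          t ^ (if a < b ∧ c < b then 1 else 0) * y ^ (if a < b ∧ b < c then 1 else 0) := by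
        rcases Nat.lt_or_gt_of_ne hbc with h | h <;> by_cases hab : a < b <;>
          simp [hab, h, Nat.not_lt.2 h.le]
      rw [e1, e2]
      ring

theorem one_le_lrminW {w : List ℕ} (hw : w ≠ []) : 1 ≤ lrminW w := by
  cases w with
  | nil => exact absurd rfl hw
  | cons x l => rw [lrminW_cons]; omega

theorem one_le_rlminW {w : List ℕ} (hw : w ≠ []) : 1 ≤ rlminW w := by
  induction w with
  | nil => exact absurd rfl hw
  | cons x l ih =>
    rw [rlminW_cons]
    cases l with
    | nil => simp
    | cons b l => exact le_add_left (ih (by simp))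

theorem prwWeight_eq {R : Type*} [CommRing R] (α y t : R) (r : ℕ) (w : List ℕ) :
    ∀ a, w.Nodup → (∀ c ∈ w, 0 < c) → (∀ c ∈ w, c < r) → 1 ∈ w → (w.headD 0 ≤ a) →
      prwWeight α y 1 1 t w = if isPRW w then α ^ (lrminW w + rlminW w - 2) *
        t ^ tripleCount (fun a b c => a < b ∧ c < b) r a w *
        y ^ tripleCount (fun a b c => a < b ∧ b < c) r a w else 0 := by
  induction w with
  | nil => simp
  | cons x l ih =>
    intro a hnd hpos hlt h1 ha
    have hxa : ¬ a < x := by simpa using ha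
    have hnd' := (List.nodup_cons.1 hnd).2
    by_cases hx : x = 1
    · subst hx
      have hl : ∀ d ∈ l, 1 < d := by
        intro d hd
        have h0 := hpos d (by simp [hd])
        have : d ≠ 1 := fun h => (List.nodup_cons.1 hnd).1 (h ▸ hd)
        omega
      have hK : prwWeight α y 1 1 t (1 :: l) = tailWeight α y 1 t 1 l := by
        cases l <;> simp [prwWeight, tailWeight]
      rw [hK, if_pos (isPRW_one_cons hl), lrminW_cons_of_forall_lt hl, rlminW_cons, if_pos hl,
        tripleCount, tripleCount, tailWeight_eq α y t r l 1 hnd' (fun c hc => hlt c (by simp [hc]))]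
      have : 1 + (1 + rlminW l) - 2 = rlminW l := by omega
      simp [hxa, this]
    · cases l with
      | nil => simp at h1; omega
      | cons b l =>
        have h1l : 1 ∈ b :: l := by
          rcases List.mem_cons.1 h1 with h | h
          · exact absurd h.symm hx
          · exact h
        have hbx : b ≠ x := fun h => by simp [h] at hnd
        rw [prwWeight, if_neg hx]
        rcases Nat.lt_or_gt_of_ne hbx with h | h
        · have hxl : ¬ ∀ d ∈ b :: l, x < d := fun h' => by
            have := h' b (by simp)
            omega
          rw [if_pos h, ih x hnd' (fun c hc => hpos c (by simp [hc]))
            (fun c hc => hlt c (by simp [hc])) h1l (by simpa using h.le),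
            tripleCount.eq_2 _ _ a, tripleCount.eq_2 _ _ a, lrminW_cons_cons_of_lt l h,
            rlminW_cons x, if_neg hxl]
          have e1 := one_le_lrminW (w := b :: l) (by simp)
          have e2 := one_le_rlminW (w := b :: l) (by simp)
          obtain ⟨k, hk⟩ : ∃ k, lrminW (b :: l) + rlminW (b :: l) = k + 2 :=
            ⟨lrminW (b :: l) + rlminW (b :: l) - 2, by omega⟩
          have e3 : 1 + lrminW (b :: l) + rlminW (b :: l) - 2 = k + 1 := by omega
          simp only [isPRW_cons_cons_of_lt l h, e3, hk, Nat.add_sub_cancel, hxa, false_and,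
            if_false, zero_add, mul_one]
          split_ifs
          · ring
          · simp
        · rw [if_neg (by omega), if_neg (not_isPRW_cons_cons l hx h)]

theorem length_word {m : ℕ} (σ : Equiv.Perm (Fin m)) : (word σ).length = m := by
  simp [word]

theorem prwWeight_word {R : Type*} [CommRing R] (α y t : R) {n : ℕ}
    (σ : Equiv.Perm (Fin (n + 1))) :
    prwWeight α y 1 1 t (word σ) = if isPRW (word σ) then
      α ^ (lrminW (word σ) + rlminW (word σ) - 2) * t ^ pkW (word σ) * y ^ daW (word σ)
      else 0 := by
  have hp := word_perm_descList σ
  have hmem : ∀ c, c ∈ word σ ↔ 0 < c ∧ c ≤ n + 1 := fun c => by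
    rw [hp.mem_iff, mem_descList]
  have hlen := length_word σ
  rw [daW_eq_tripleCount, pkW_eq_tripleCount]
  refine prwWeight_eq α y t _ _ _ (hp.nodup_iff.2 (nodup_descList _))
    (fun c hc => ((hmem c).1 hc).1) (fun c hc => ?_) ((hmem 1).2 (by omega)) ?_
  · have := (hmem c).1 hc
    omega
  · cases h : word σ with
    | nil => simp
    | cons x l =>
      have := (hmem x).1 (by simp [h])
      rw [← h, hlen, h, List.headD_cons]
      omega

theorem coeff_sum_prwWeight (n k : ℕ) (c y : ℤ) :
    (∑ σ : Equiv.Perm (Fin (n + 1)), prwWeight (Polynomial.C (Polynomial.X : Polynomial ℤ))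
        (Polynomial.C (Polynomial.C y)) 1 1 (Polynomial.C (Polynomial.C c) * Polynomial.X)
        (word σ)).coeff k =
      Polynomial.C (c ^ k) * ∑ σ ∈ (PRW (n + 1)).filter (fun σ => pkW (word σ) = k),
        (Polynomial.X : Polynomial ℤ) ^ (lrminW (word σ) + rlminW (word σ) - 2) *
          Polynomial.C y ^ daW (word σ) := by
  rw [Polynomial.finsetSum_coeff, PRW, Finset.filter_filter, Finset.sum_filter, Finset.mul_sum]
  refine Finset.sum_congr rfl fun σ _ => ?_
  rw [prwWeight_word]
  by_cases h : isPRW (word σ)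
  · rw [if_pos h]
    have : Polynomial.C (Polynomial.X : Polynomial ℤ) ^ (lrminW (word σ) + rlminW (word σ) - 2) *
        (Polynomial.C (Polynomial.C c) * Polynomial.X) ^ pkW (word σ) *
        Polynomial.C (Polynomial.C y) ^ daW (word σ) =
        Polynomial.C (Polynomial.C (c ^ pkW (word σ)) *
          (Polynomial.X ^ (lrminW (word σ) + rlminW (word σ) - 2) *
          Polynomial.C y ^ daW (word σ))) * Polynomial.X ^ pkW (word σ) := by
      simp only [Polynomial.C_mul, Polynomial.C_pow]
      ring
    rw [this, Polynomial.coeff_C_mul_X_pow]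
    by_cases hk : pkW (word σ) = k
    · rw [if_pos hk.symm, if_pos ⟨h, hk⟩, hk]
    · rw [if_neg (Ne.symm hk), if_neg (fun h' => hk h'.2), mul_zero]
  · rw [if_neg h, if_neg (fun h' => h h'.1), mul_zero, Polynomial.coeff_zero]

/-- equivalence of \eqref{PRW-g-1} and \eqref{PRW-g-2}: the generating
polynomial of `LRmin + RLmin - 2` over permutations in `PRW_{n+1}` with `k` peaks equals
`2^{n-2k}` times the one over permutations in `PRW_{n+1}` with `k` ascents and no double
ascents, as polynomials in `ℤ[α]`. -/
theorem gamma_peak_interpretation (n k : ℕ) (hn : 1 ≤ n) (hk : 2 * k ≤ n) :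
    ∑ σ ∈ (PRW (n + 1)).filter (fun σ => pkW (word σ) = k),
        (Polynomial.X : Polynomial ℤ) ^ (lrminW (word σ) + rlminW (word σ) - 2)
      = 2 ^ (n - 2 * k) *
        ∑ σ ∈ (PRW (n + 1)).filter (fun σ => ascW (word σ) = k ∧ daW (word σ) = 0),
          (Polynomial.X : Polynomial ℤ) ^ (lrminW (word σ) + rlminW (word σ) - 2) := by
  have key := sum_prwWeight_shift (Polynomial.C (Polynomial.X : Polynomial ℤ)) Polynomial.X n
  rw [← sum_word, ← sum_word] at key
  have h4 := coeff_sum_prwWeight n k 4 1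
  have h1 := coeff_sum_prwWeight n k 1 0
  simp only [map_one, map_zero, one_pow, one_mul, mul_one, map_ofNat] at h4 h1
  rw [key, ← Polynomial.C_ofNat, ← Polynomial.C_pow, Polynomial.coeff_C_mul, h1] at h4
  have hR : ∑ σ ∈ (PRW (n + 1)).filter (fun σ => pkW (word σ) = k),
        (Polynomial.X : Polynomial ℤ) ^ (lrminW (word σ) + rlminW (word σ) - 2) *
          0 ^ daW (word σ) =
      ∑ σ ∈ (PRW (n + 1)).filter (fun σ => ascW (word σ) = k ∧ daW (word σ) = 0),
          (Polynomial.X : Polynomial ℤ) ^ (lrminW (word σ) + rlminW (word σ) - 2) := by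
    rw [Finset.sum_filter, Finset.sum_filter]
    refine Finset.sum_congr rfl fun σ _ => ?_
    have hp := word_perm_descList σ
    have hasc : ascW (word σ) = daW (word σ) + pkW (word σ) := by
      refine ascW_eq_daW_add_pkW (hp.nodup_iff.2 (nodup_descList _)) (fun x hx => ?_) ?_
      · rw [length_word]
        exact (mem_descList.1 (hp.mem_iff.1 hx)).2
      · rw [← List.length_pos_iff, length_word]
        omega
    rw [hasc]
    by_cases h0 : daW (word σ) = 0 <;> simp [h0]
  rw [hR] at h4
  have hpow : (2 : Polynomial ℤ) ^ n = 4 ^ k * 2 ^ (n - 2 * k) := by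
    rw [show (4 : Polynomial ℤ) = 2 ^ 2 by norm_num, ← pow_mul, ← pow_add]
    congr 1
    omega
  rw [hpow, mul_assoc] at h4
  have h40 : (4 : Polynomial ℤ) ^ k ≠ 0 := pow_ne_zero k (by norm_num)
  refine (mul_left_cancel₀ h40 ?_).symm
  rw [h4, Polynomial.C_pow, Polynomial.C_ofNat]
end

section
/- Let n ≥ 1 and let u, v, w, α be real numbers with (w+v)² ≥ 4uvw. Set x = ((w+v) − √((w+v)² − 4uvw))/2 and y = ((w+v) + √((w+v)² − 4uvw))/2. Then ∑_{σ∈PRW_{n+1}} u^{M(σ)} v^{des(σ)} w^{asc(σ)} α^{LRmin(σ)+RLmin(σ)−2} = ∑_{σ∈PRW_{n+1}} x^{des(σ)} y^{asc(σ)} α^{LRmin(σ)+RLmin(σ)−2}. -/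
/-- All arrangements of the elements of `s` into a word without repetitions. -/
def arrangements (s : Finset ℕ) : Finset (List ℕ) := s.val.lists.toFinset

lemma mem_arrangements {s : Finset ℕ} {l : List ℕ} :
    l ∈ arrangements s ↔ l.Nodup ∧ l.toFinset = s := by
  unfold arrangements
  rw [Multiset.mem_toFinset, Multiset.mem_lists_iff]
  constructor
  · intro h
    have hn : l.Nodup := by
      have := s.nodup
      rw [h] at this
      exact Multiset.coe_nodup.1 this
    refine ⟨hn, Finset.val_inj.1 ?_⟩
    rw [h, List.toFinset_val, List.dedup_eq_self.2 hn]
    rfl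
  · rintro ⟨hn, rfl⟩
    rw [List.toFinset_val, List.dedup_eq_self.2 hn]
    rfl

lemma arrangements_empty : arrangements ∅ = {[]} := by
  ext l
  rw [mem_arrangements, Finset.mem_singleton, List.toFinset_eq_empty_iff]
  constructor
  · exact fun h => h.2
  · rintro rfl
    simp

/-- Arrangements of `s` are classified by the sets of letters before and after a given letter. -/
lemma sum_arrangements_split {s : Finset ℕ} {m : ℕ} (hm : m ∈ s) (f : List ℕ → ℝ) :
    ∑ l ∈ arrangements s, f l =
      ∑ A ∈ (s.erase m).powerset, ∑ a ∈ arrangements A,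
        ∑ b ∈ arrangements (s.erase m \ A), f (a ++ m :: b) := by
  simp_rw [Finset.sum_sigma']
  symm
  refine Finset.sum_bij (fun p _ => p.2.1 ++ m :: p.2.2) ?_ ?_ ?_ ?_
  · rintro ⟨A, a, b⟩ h
    simp only [Finset.mem_sigma, Finset.mem_powerset, mem_arrangements] at h ⊢
    obtain ⟨hA, ⟨ha, rfl⟩, hb, hb'⟩ := h
    have hbm : ∀ x, x ∈ b ↔ (x ≠ m ∧ x ∈ s) ∧ x ∉ a := by
      intro x
      rw [← List.mem_toFinset, hb']
      simp
    have ham : ∀ x ∈ a, x ≠ m ∧ x ∈ s := by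
      intro x hx
      simpa using hA (List.mem_toFinset.2 hx)
    constructor
    · rw [List.nodup_append, List.nodup_cons]
      refine ⟨ha, ⟨fun h => ((hbm m).1 h).1.1 rfl, hb⟩, ?_⟩
      rintro x hx y hy rfl
      rcases List.mem_cons.1 hy with rfl | hy
      · exact (ham _ hx).1 rfl
      · exact ((hbm x).1 hy).2 hx
    · ext x
      simp only [List.mem_toFinset, List.mem_append, List.mem_cons, hbm]
      constructor
      · rintro (h | rfl | h)
        · exact (ham x h).2
        · exact hm
        · exact h.1.2
      · intro h
        by_cases h1 : x = m <;> by_cases h2 : x ∈ a <;> simp [*]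
  · rintro ⟨A, a, b⟩ h ⟨A', a', b'⟩ h' heq
    simp only [Finset.mem_sigma, Finset.mem_powerset, mem_arrangements] at h h'
    obtain ⟨hA, ⟨ha, rfl⟩, hb, hb'⟩ := h
    obtain ⟨hA', ⟨ha', rfl⟩, hc, hc'⟩ := h'
    have h1 : m ∉ a := fun h => by simpa using hA (List.mem_toFinset.2 h)
    have h2 : m ∉ a' := fun h => by simpa using hA' (List.mem_toFinset.2 h)
    have h3 : m ∉ b := fun h => by
      have := List.mem_toFinset.2 h
      rw [hb'] at this
      simp at this
    have := (List.append_cons_inj_of_notMem h1 h3).1 heq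
    obtain ⟨rfl, _, rfl⟩ := this
    rfl
  · intro l hl
    rw [mem_arrangements] at hl
    obtain ⟨hn, rfl⟩ := hl
    obtain ⟨a, b, rfl⟩ := List.append_of_mem (List.mem_toFinset.1 hm)
    rw [List.nodup_append, List.nodup_cons] at hn
    obtain ⟨ha, ⟨hmb, hb⟩, hab⟩ := hn
    have hma : m ∉ a := fun h => hab m h m (by simp) rfl
    refine ⟨⟨a.toFinset, a, b⟩, ?_, rfl⟩
    simp only [Finset.mem_sigma, Finset.mem_powerset, mem_arrangements, ha, hb, true_and, and_true]
    constructor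
    · intro x hx
      have hx := List.mem_toFinset.1 hx
      have : x ≠ m := fun h => hma (h ▸ hx)
      simp [this, hx]
    · ext x
      simp only [List.mem_toFinset, Finset.mem_sdiff, Finset.mem_erase, List.mem_append,
        List.mem_cons]
      constructor
      · intro h
        exact ⟨⟨fun h' => hmb (h' ▸ h), Or.inr (Or.inr h)⟩, fun h' => hab x h' x (by simp [h]) rfl⟩
      · tauto
  · intros
    rfl

/-- The weight of a word: `v` for each descent, `w` for each ascent, `u` for each inner peak. -/
def wordWeight (u v w : ℝ) : List ℕ → ℝ
  | a :: b :: c :: l => (if b < a then v else 1) * (if a < b then w else 1) *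
      (if a < b ∧ c < b then u else 1) * wordWeight u v w (b :: c :: l)
  | [a, b] => (if b < a then v else 1) * (if a < b then w else 1)
  | _ => 1

section Weights

variable (u v w : ℝ)

lemma wordWeight_append_of_desc {p m : ℕ} (h : m < p) (b : List ℕ) : ∀ a : List ℕ,
    wordWeight u v w (a ++ p :: m :: b) =
      wordWeight u v w (a ++ [p, m]) * wordWeight u v w (m :: b)
  | [] => by cases b <;> simp [wordWeight, h, h.not_gt]
  | [x] => by
    have := wordWeight_append_of_desc h b []
    simp only [List.nil_append, List.cons_append, wordWeight] at this ⊢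
    rw [this]
    ring
  | x :: y :: [] => by
    have := wordWeight_append_of_desc h b [y]
    simp only [List.nil_append, List.cons_append] at this ⊢
    rw [wordWeight, this, wordWeight.eq_1 (l := [m])]
    ring
  | x :: y :: z :: a => by
    have := wordWeight_append_of_desc h b (y :: z :: a)
    simp only [List.cons_append] at this ⊢
    rw [wordWeight, this, wordWeight.eq_1 (l := a ++ [p, m])]
    ring

lemma wordWeight_head {m m' c : ℕ} (h : m < c) (h' : m' < c) (l : List ℕ) :
    wordWeight u v w (m :: c :: l) = wordWeight u v w (m' :: c :: l) := by
  cases l <;> simp [wordWeight, h, h', h.not_gt, h'.not_gt]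

lemma wordWeight_cons_congr {m m' : ℕ} {b : List ℕ} (h : ∀ x ∈ b, m < x) (h' : ∀ x ∈ b, m' < x) :
    wordWeight u v w (m :: b) = wordWeight u v w (m' :: b) := by
  cases b with
  | nil => simp [wordWeight]
  | cons c b => exact wordWeight_head _ _ _ (h c (by simp)) (h' c (by simp)) _

lemma wordWeight_last {m m' c : ℕ} (h : m < c) (h' : m' < c) (a : List ℕ) :
    wordWeight u v w (a ++ [c, m]) = wordWeight u v w (a ++ [c, m']) := by
  induction a with
  | nil => simp [wordWeight, h, h', h.not_gt, h'.not_gt]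
  | cons x a ih =>
    cases a with
    | nil => simp_all [wordWeight]
    | cons y a =>
      cases a with
      | nil => simp_all [wordWeight]
      | cons z a =>
        simp only [List.cons_append] at ih ⊢
        rw [wordWeight, ih, wordWeight.eq_1 (l := a ++ [c, m'])]

lemma wordWeight_of_decreasing : ∀ a : List ℕ, a.Pairwise (· > ·) →
    wordWeight u v w a = v ^ (a.length - 1)
  | [], _ => by simp [wordWeight]
  | [_], _ => by simp [wordWeight]
  | [x, y], h => by
    have h : y < x := by simpa using h
    simp [wordWeight, h, h.not_gt]
  | x :: y :: z :: a, h => by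
    have h1 : y < x := (List.pairwise_cons.1 h).1 y (by simp)
    rw [wordWeight, wordWeight_of_decreasing _ (List.pairwise_cons.1 h).2]
    simp [h1, h1.not_gt, pow_succ']

end Weights

/-- The number of right-to-left minima of a word. -/
def rightMinima : List ℕ → ℕ
  | [] => 0
  | a :: l => (if ∀ b ∈ l, a < b then 1 else 0) + rightMinima l

lemma rightMinima_append {m : ℕ} {a b : List ℕ} (ha : ∀ x ∈ a, m < x) (hb : ∀ x ∈ b, m < x) :
    rightMinima (a ++ m :: b) = 1 + rightMinima b := by
  induction a with
  | nil => rw [List.nil_append, rightMinima, if_pos hb]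
  | cons x a ih =>
    have hx : ¬ ∀ y ∈ a ++ m :: b, x < y := fun h =>
      (h m (by simp)).not_gt (ha x (by simp))
    rw [List.cons_append, rightMinima, if_neg hx, ih (fun y hy => ha y (by simp [hy])), zero_add]

/-- The enumerator of the arrangements of `s` placed between two small letters. -/
noncomputable def innerSum (u v w : ℝ) (s : Finset ℕ) : ℝ :=
  ∑ l ∈ arrangements s, wordWeight u v w (0 :: (l ++ [0]))

/-- The enumerator of the arrangements of `s` placed after a small letter, with `α` marking
right-to-left minima. -/
noncomputable def tailSum (u v w α : ℝ) (s : Finset ℕ) : ℝ :=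
  ∑ l ∈ arrangements s, wordWeight u v w (0 :: l) * α ^ rightMinima l

/-- The enumerator of pairs of a decreasing word and an arrangement of the other letters. -/
noncomputable def totalSum (u v w α : ℝ) (s : Finset ℕ) : ℝ :=
  ∑ A ∈ s.powerset, (v * α) ^ A.card * tailSum u v w α (s \ A)

section Recurrences

variable (u v w α : ℝ)

lemma wordWeight_between {m : ℕ} (hm : 0 < m) {a b : List ℕ} (ha : ∀ x ∈ a, m < x)
    (hb : ∀ x ∈ b, m < x) :
    wordWeight u v w (0 :: (a ++ m :: b ++ [0])) =
      if a = [] then (if b = [] then u * v * w else w * wordWeight u v w (0 :: (b ++ [0])))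
      else (if b = [] then wordWeight u v w (0 :: (a ++ [0])) * v
        else wordWeight u v w (0 :: (a ++ [0])) * wordWeight u v w (0 :: (b ++ [0]))) := by
  have hb' : ∀ {b : List ℕ}, b ≠ [] → (∀ x ∈ b, m < x) →
      wordWeight u v w (m :: (b ++ [0])) = wordWeight u v w (0 :: (b ++ [0])) := by
    intro b h1 h2
    cases b with
    | nil => exact absurd rfl h1
    | cons c b => exact wordWeight_head _ _ _ (h2 c (by simp)) (hm.trans (h2 c (by simp))) _
  rcases List.eq_nil_or_concat a with rfl | ⟨a, p, rfl⟩
  · rw [if_pos rfl]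
    split_ifs with h
    · subst h
      simp [wordWeight, hm]
      ring
    · obtain ⟨c, b, rfl⟩ := List.exists_cons_of_ne_nil h
      have hc := hb c (by simp)
      rw [← hb' h hb]
      simp [wordWeight, hm, hc.not_gt]
  · have hp : m < p := ha p (by simp)
    have e : (0 :: (a.concat p ++ m :: b ++ [0])) = (0 :: a) ++ p :: m :: (b ++ [0]) := by simp
    have e' : (0 :: (a.concat p ++ [0])) = (0 :: a) ++ [p, 0] := by simp
    rw [e, e', wordWeight_append_of_desc _ _ _ hp, wordWeight_last u v w hp (hm.trans hp),
      if_neg (by simp)]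
    split_ifs with h
    · subst h
      simp [wordWeight, hm]
    · rw [hb' h hb]

lemma wordWeight_after {m : ℕ} (hm : 0 < m) {a b : List ℕ} (ha : ∀ x ∈ a, m < x)
    (hb : ∀ x ∈ b, m < x) :
    wordWeight u v w (0 :: (a ++ m :: b)) =
      (if a = [] then w else wordWeight u v w (0 :: (a ++ [0]))) * wordWeight u v w (0 :: b) := by
  rw [← wordWeight_cons_congr u v w hb fun x hx => hm.trans (hb x hx)]
  rcases List.eq_nil_or_concat a with rfl | ⟨a, p, rfl⟩
  · cases b with
    | nil => simp [wordWeight, hm]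
    | cons c b =>
      have hc := hb c (by simp)
      simp [wordWeight, hm, hc.not_gt]
  · have hp : m < p := ha p (by simp)
    have e : (0 :: (a.concat p ++ m :: b)) = (0 :: a) ++ p :: m :: b := by simp
    have e' : (0 :: (a.concat p ++ [0])) = (0 :: a) ++ [p, 0] := by simp
    rw [e, e', wordWeight_append_of_desc _ _ _ hp, wordWeight_last u v w hp (hm.trans hp),
      if_neg (by simp)]

lemma eq_nil_iff_of_mem_arrangements {s : Finset ℕ} {l : List ℕ} (h : l ∈ arrangements s) :
    l = [] ↔ s = ∅ := by
  rw [mem_arrangements] at h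
  rw [← h.2, List.toFinset_eq_empty_iff]

lemma lt_of_mem_arrangements {s A : Finset ℕ} {m : ℕ} (hmin : ∀ x ∈ s, m ≤ x)
    (hA : A ⊆ s.erase m) {l : List ℕ} (h : l ∈ arrangements A) : ∀ x ∈ l, m < x := by
  intro x hx
  rw [mem_arrangements] at h
  have := hA (h.2 ▸ List.mem_toFinset.2 hx)
  rw [Finset.mem_erase] at this
  exact lt_of_le_of_ne (hmin x this.2) (Ne.symm this.1)

lemma innerSum_eq {s : Finset ℕ} {m : ℕ} (hm : 0 < m) (hms : m ∈ s) (hmin : ∀ x ∈ s, m ≤ x) :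
    innerSum u v w s = ∑ A ∈ (s.erase m).powerset,
      if A = ∅ then (if s.erase m \ A = ∅ then u * v * w else w * innerSum u v w (s.erase m \ A))
      else (if s.erase m \ A = ∅ then innerSum u v w A * v
        else innerSum u v w A * innerSum u v w (s.erase m \ A)) := by
  rw [innerSum, sum_arrangements_split hms]
  refine Finset.sum_congr rfl fun A hA => ?_
  have hA := Finset.mem_powerset.1 hA
  have key : ∀ a ∈ arrangements A, ∀ b ∈ arrangements (s.erase m \ A),
      wordWeight u v w (0 :: (a ++ m :: b ++ [0])) =
      if A = ∅ then (if s.erase m \ A = ∅ then u * v * w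
        else w * wordWeight u v w (0 :: (b ++ [0])))
      else (if s.erase m \ A = ∅ then wordWeight u v w (0 :: (a ++ [0])) * v
        else wordWeight u v w (0 :: (a ++ [0])) * wordWeight u v w (0 :: (b ++ [0]))) := by
    intro a ha b hb
    rw [wordWeight_between u v w hm (lt_of_mem_arrangements hmin hA ha)
      (lt_of_mem_arrangements hmin Finset.sdiff_subset hb)]
    simp only [eq_nil_iff_of_mem_arrangements ha, eq_nil_iff_of_mem_arrangements hb]
  rw [Finset.sum_congr rfl fun a ha => Finset.sum_congr rfl fun b hb => key a ha b hb]
  split_ifs with h1 h2 h2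
  · rw [h2, h1]
    simp [arrangements_empty]
  · subst h1
    simp [arrangements_empty, innerSum, Finset.mul_sum]
  · rw [h2]
    simp [arrangements_empty, innerSum, Finset.sum_mul]
  · simp_rw [innerSum, Finset.sum_mul_sum]

lemma tailSum_eq {s : Finset ℕ} {m : ℕ} (hm : 0 < m) (hms : m ∈ s) (hmin : ∀ x ∈ s, m ≤ x) :
    tailSum u v w α s = ∑ A ∈ (s.erase m).powerset,
      α * (if A = ∅ then w else innerSum u v w A) * tailSum u v w α (s.erase m \ A) := by
  rw [tailSum, sum_arrangements_split hms]
  refine Finset.sum_congr rfl fun A hA => ?_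
  have hA := Finset.mem_powerset.1 hA
  have key : ∀ a ∈ arrangements A, ∀ b ∈ arrangements (s.erase m \ A),
      wordWeight u v w (0 :: (a ++ m :: b)) * α ^ rightMinima (a ++ m :: b) =
      (if A = ∅ then w else wordWeight u v w (0 :: (a ++ [0]))) *
        (wordWeight u v w (0 :: b) * α ^ rightMinima b * α) := fun a ha b hb => by
    have h1 := lt_of_mem_arrangements hmin hA ha
    have h2 := lt_of_mem_arrangements hmin Finset.sdiff_subset hb
    rw [wordWeight_after u v w hm h1 h2, rightMinima_append h1 h2, pow_add,
      if_congr (eq_nil_iff_of_mem_arrangements ha) rfl rfl]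
    ring
  rw [Finset.sum_congr rfl fun a ha => Finset.sum_congr rfl fun b hb => key a ha b hb,
    ← Finset.sum_mul_sum, ← Finset.sum_mul, tailSum]
  split_ifs with h
  · subst h
    simp [arrangements_empty]
    ring
  · rw [innerSum]
    ring

lemma totalSum_eq {s : Finset ℕ} {m : ℕ} (hm : 0 < m) (hms : m ∈ s) (hmin : ∀ x ∈ s, m ≤ x) :
    totalSum u v w α s = ∑ A ∈ (s.erase m).powerset,
      α * (if A = ∅ then v + w else innerSum u v w A) * totalSum u v w α (s.erase m \ A) := by
  set t := s.erase m with ht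
  have hmt : m ∉ t := by simp [ht]
  have hst : s = insert m t := by rw [ht, Finset.insert_erase hms]
  have h1 : totalSum u v w α s = (∑ A ∈ t.powerset, (v * α) ^ A.card * tailSum u v w α (s \ A)) +
      v * α * totalSum u v w α t := by
    rw [totalSum, hst, Finset.sum_powerset_insert hmt, totalSum, Finset.mul_sum]
    congr 1
    refine Finset.sum_congr rfl fun A hA => ?_
    have hmA : m ∉ A := fun h => hmt (Finset.mem_powerset.1 hA h)
    rw [Finset.card_insert_of_notMem hmA, Finset.insert_sdiff_insert,
      Finset.sdiff_insert_of_notMem hmt]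
    ring
  have h2 : ∑ A ∈ t.powerset, (v * α) ^ A.card * tailSum u v w α (s \ A) =
      ∑ C ∈ t.powerset, α * (if C = ∅ then w else innerSum u v w C) *
        totalSum u v w α (t \ C) := by
    simp_rw [totalSum, Finset.mul_sum]
    have : ∀ A ∈ t.powerset, (v * α) ^ A.card * tailSum u v w α (s \ A) =
        ∑ C ∈ (t \ A).powerset, (v * α) ^ A.card *
          (α * (if C = ∅ then w else innerSum u v w C) * tailSum u v w α ((t \ A) \ C)) := by
      intro A hA
      have hmA : m ∉ A := fun h => hmt (Finset.mem_powerset.1 hA h)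
      have e : (s \ A).erase m = t \ A := by
        rw [ht, Finset.erase_sdiff_comm]
      rw [tailSum_eq u v w α hm (Finset.mem_sdiff.2 ⟨hms, hmA⟩)
        (fun x hx => hmin x (Finset.mem_sdiff.1 hx).1), e, Finset.mul_sum]
    rw [Finset.sum_congr rfl this]
    rw [Finset.sum_comm' (t' := t.powerset) (s' := fun C => (t \ C).powerset)]
    · refine Finset.sum_congr rfl fun C _ => Finset.sum_congr rfl fun A _ => ?_
      rw [sdiff_right_comm]
      ring
    · intro A C
      simp only [Finset.mem_powerset, Finset.subset_sdiff]
      rw [disjoint_comm]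
      tauto
  rw [h1, h2]
  have h3 : v * α * totalSum u v w α t =
      ∑ C ∈ t.powerset, if C = ∅ then v * α * totalSum u v w α (t \ C) else 0 := by
    rw [Finset.sum_ite_eq' t.powerset ∅, if_pos (by simp), Finset.sdiff_empty]
  rw [h3, ← Finset.sum_add_distrib]
  refine Finset.sum_congr rfl fun C _ => ?_
  split_ifs <;> ring

end Recurrences

section Comparison

variable {u v w u' v' w' : ℝ}

lemma innerSum_congr (hs : v + w = v' + w') (hp : u * v * w = u' * v' * w') (s : Finset ℕ)
    (hs0 : s.Nonempty) (hpos : ∀ x ∈ s, 0 < x) : innerSum u v w s = innerSum u' v' w' s := by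
  induction s using Finset.strongInduction with
  | H s ih =>
    obtain ⟨m, hm, hmin⟩ := s.exists_min_image id hs0
    have hlt : ∀ {B : Finset ℕ}, B ⊆ s.erase m → B ⊂ s := fun h =>
      lt_of_le_of_lt h (Finset.erase_ssubset hm)
    have ih' : ∀ B ⊆ s.erase m, B ≠ ∅ → innerSum u v w B = innerSum u' v' w' B := fun B hB hB0 =>
      ih B (hlt hB) (Finset.nonempty_iff_ne_empty.2 hB0) fun x hx => hpos x ((hlt hB).1 hx)
    rw [innerSum_eq u v w (hpos m hm) hm hmin, innerSum_eq u' v' w' (hpos m hm) hm hmin]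
    by_cases h0 : s.erase m = ∅
    · simp [h0, hp]
    · have split : ∀ u v w : ℝ, (∑ A ∈ (s.erase m).powerset,
          if A = ∅ then (if s.erase m \ A = ∅ then u * v * w
            else w * innerSum u v w (s.erase m \ A))
          else (if s.erase m \ A = ∅ then innerSum u v w A * v
            else innerSum u v w A * innerSum u v w (s.erase m \ A))) =
          (v + w) * innerSum u v w (s.erase m) + ∑ A ∈ (s.erase m).powerset,
            if A = ∅ ∨ s.erase m \ A = ∅ then 0
              else innerSum u v w A * innerSum u v w (s.erase m \ A) := by
        intro u v w
        have e1 : w * innerSum u v w (s.erase m) = ∑ A ∈ (s.erase m).powerset,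
            if A = ∅ then w * innerSum u v w (s.erase m) else 0 := by
          rw [Finset.sum_ite_eq' _ ∅, if_pos (by simp)]
        have e2 : v * innerSum u v w (s.erase m) = ∑ A ∈ (s.erase m).powerset,
            if A = s.erase m then v * innerSum u v w (s.erase m) else 0 := by
          rw [Finset.sum_ite_eq' _ (s.erase m), if_pos (by simp)]
        rw [add_mul, e1, e2, ← Finset.sum_add_distrib, ← Finset.sum_add_distrib]
        refine Finset.sum_congr rfl fun A hA => ?_
        have hA := Finset.mem_powerset.1 hA
        by_cases hA0 : A = ∅
        · subst hA0
          simp [h0, Ne.symm h0]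
        · by_cases hA1 : A = s.erase m
          · subst hA1
            simp [h0, mul_comm]
          · have : s.erase m \ A ≠ ∅ := fun h =>
              hA1 (Finset.Subset.antisymm hA (Finset.sdiff_eq_empty_iff_subset.1 h))
            simp only [if_neg hA1, hA0, this, or_self, if_false]
            ring
      rw [split, split, hs, ih' _ subset_rfl h0]
      congr 1
      refine Finset.sum_congr rfl fun A hA => ?_
      split_ifs with h
      · rfl
      · push Not at h
        rw [ih' A (Finset.mem_powerset.1 hA) h.1.ne_empty, ih' _ Finset.sdiff_subset h.2.ne_empty]

lemma totalSum_congr (hs : v + w = v' + w') (hp : u * v * w = u' * v' * w') (α : ℝ)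
    (s : Finset ℕ) (hpos : ∀ x ∈ s, 0 < x) : totalSum u v w α s = totalSum u' v' w' α s := by
  induction s using Finset.strongInduction with
  | H s ih =>
    rcases s.eq_empty_or_nonempty with rfl | hs0
    · simp [totalSum, tailSum, arrangements_empty, wordWeight]
    obtain ⟨m, hm, hmin⟩ := s.exists_min_image id hs0
    have hlt : ∀ {B : Finset ℕ}, B ⊆ s.erase m → B ⊂ s := fun h =>
      lt_of_le_of_lt h (Finset.erase_ssubset hm)
    rw [totalSum_eq u v w α (hpos m hm) hm hmin, totalSum_eq u' v' w' α (hpos m hm) hm hmin]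
    refine Finset.sum_congr rfl fun A hA => ?_
    have hA := Finset.mem_powerset.1 hA
    have hB : s.erase m \ A ⊆ s.erase m := Finset.sdiff_subset
    rw [ih _ (hlt hB) fun x hx => hpos x ((hlt hB).1 hx), hs]
    congr 2
    split_ifs with h
    · rfl
    · exact innerSum_congr hs hp A (Finset.nonempty_iff_ne_empty.2 h)
        fun x hx => hpos x ((hlt hA).1 hx)

end Comparison

@[to_additive]
lemma prod_Icc_eq_prod_range {M : Type*} [CommMonoid M] (f : ℕ → M) (k : ℕ) :
    ∏ i ∈ Finset.Icc 1 k, f i = ∏ i ∈ Finset.range k, f (i + 1) := by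
  induction k with
  | zero => simp
  | succ k ih => rw [Finset.prod_Icc_succ_top (by omega), ih, Finset.prod_range_succ]

lemma pow_card_filter (u : ℝ) (s : Finset ℕ) (p : ℕ → Prop) [DecidablePred p] :
    u ^ (s.filter p).card = ∏ i ∈ s, if p i then u else 1 := by
  rw [Finset.prod_ite]
  simp

lemma wB_succ {l : List ℕ} {i : ℕ} (h : i < l.length) : wB l (i + 1) = l.getD i 0 := by
  rw [wB, if_pos ⟨by omega, by omega⟩]
  rfl

lemma wB_zero (l : List ℕ) : wB l 0 = l.length + 1 := by simp [wB]

lemma wB_length_succ (l : List ℕ) : wB l (l.length + 1) = l.length + 1 := by simp [wB]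

lemma wordWeight_eq_prod (u v w : ℝ) : ∀ l : List ℕ, wordWeight u v w l =
    (∏ i ∈ Finset.range (l.length - 2),
      if l.getD i 0 < l.getD (i + 1) 0 ∧ l.getD (i + 2) 0 < l.getD (i + 1) 0 then u else 1) *
    (∏ i ∈ Finset.range (l.length - 1), if l.getD (i + 1) 0 < l.getD i 0 then v else 1) *
    ∏ i ∈ Finset.range (l.length - 1), if l.getD i 0 < l.getD (i + 1) 0 then w else 1
  | [] => by simp [wordWeight]
  | [_] => by simp [wordWeight]
  | [a, b] => by simp [wordWeight]
  | a :: b :: c :: l => by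
    rw [wordWeight, wordWeight_eq_prod u v w (b :: c :: l)]
    simp only [List.length_cons, Nat.add_sub_cancel, Nat.reduceSubDiff, Finset.prod_range_succ',
      List.getD_cons_succ, List.getD_cons_zero]
    ring

lemma weight_word_eq (u v w : ℝ) {l : List ℕ} (hl : ∀ x ∈ l, x ≤ l.length) :
    u ^ pkW l * v ^ desW l * w ^ ascW l = wordWeight u v w l := by
  rw [pkW, desW, ascW, wordWeight_eq_prod, pow_card_filter, pow_card_filter, pow_card_filter,
    prod_Icc_eq_prod_range, prod_Icc_eq_prod_range, prod_Icc_eq_prod_range]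
  congr 1
  · congr 1
    · have hle : ∀ i, i < l.length → wB l (i + 1) ≤ l.length := by
        intro i hi
        rw [wB_succ hi, List.getD_eq_getElem _ _ hi]
        exact hl _ (List.getElem_mem hi)
      rcases Nat.lt_or_ge l.length 2 with h | h
      · rw [Nat.sub_eq_zero_of_le (by omega), Finset.prod_range_zero]
        refine Finset.prod_eq_one fun i hi => if_neg ?_
        have hi := Finset.mem_range.1 hi
        obtain rfl : i = 0 := by omega
        have := hle 0 hi
        simp only [isPkat, Nat.zero_add, Nat.sub_self, wB_zero] at this ⊢
        omega
      · obtain ⟨k, hk⟩ : ∃ k, l.length = k + 2 := ⟨l.length - 2, by omega⟩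
        have h0 : ¬ isPkat l (k + 1 + 1) := by
          have h1 := hle (k + 1) (by omega)
          have h2 := wB_length_succ l
          rw [hk] at h1 h2
          exact fun h => by linarith [h.2]
        have h1 : ¬ isPkat l (0 + 1) := by
          have h1 := hle 0 (by omega)
          simp only [isPkat, Nat.zero_add, Nat.sub_self, wB_zero] at h1 ⊢
          omega
        rw [hk, Finset.prod_range_succ, Finset.prod_range_succ', if_neg h0, if_neg h1, mul_one,
          mul_one, Nat.add_sub_cancel]
        refine Finset.prod_congr rfl fun i hi => ?_
        have hi := Finset.mem_range.1 hi
        simp only [isPkat, Nat.add_sub_cancel]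
        rw [wB_succ (by omega), wB_succ (by omega), wB_succ (by omega)]
    · refine Finset.prod_congr rfl fun i hi => ?_
      have hi := Finset.mem_range.1 hi
      rw [wB_succ (by omega), wB_succ (by omega)]
  · refine Finset.prod_congr rfl fun i hi => ?_
    have hi := Finset.mem_range.1 hi
    rw [wB_succ (by omega), wB_succ (by omega)]

lemma rightMinima_eq_sum (l : List ℕ) : rightMinima l = ∑ i ∈ Finset.range l.length,
    if ∀ j < l.length, i < j → l.getD i 0 < l.getD j 0 then 1 else 0 := by
  induction l with
  | nil => rfl
  | cons a l ih =>
    rw [rightMinima, ih, List.length_cons, Finset.sum_range_succ', add_comm]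
    congr 1
    · refine Finset.sum_congr rfl fun i _ => if_congr ?_ rfl rfl
      constructor
      · intro h j hj hij
        obtain ⟨j, rfl⟩ : ∃ k, j = k + 1 := ⟨j - 1, by omega⟩
        simpa using h j (by omega) (by omega)
      · intro h j hj hij
        simpa using h (j + 1) (by omega) (by omega)
    · refine if_congr ?_ rfl rfl
      constructor
      · intro h j hj hij
        obtain ⟨j, rfl⟩ : ∃ k, j = k + 1 := ⟨j - 1, by omega⟩
        have hj' : j < l.length := by omega
        rw [List.getD_cons_zero, List.getD_cons_succ, List.getD_eq_getElem _ _ hj']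
        exact h _ (List.getElem_mem hj')
      · intro h x hx
        obtain ⟨j, hj, rfl⟩ := List.getElem_of_mem hx
        have := h (j + 1) (by omega) (by omega)
        rwa [List.getD_cons_zero, List.getD_cons_succ, List.getD_eq_getElem _ _ hj] at this

lemma rlminW_eq (l : List ℕ) : rlminW l = rightMinima l := by
  rw [rlminW, Finset.card_filter, sum_Icc_eq_sum_range, rightMinima_eq_sum]
  refine Finset.sum_congr rfl fun i hi => if_congr ?_ rfl rfl
  have hi := Finset.mem_range.1 hi
  simp only [isRLat, Finset.mem_Icc]
  constructor
  · intro h j hj hij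
    have := h (j + 1) ⟨by omega, by omega⟩
    rwa [wB_succ hi, wB_succ hj] at this
  · intro h j hj
    obtain ⟨j, rfl⟩ : ∃ k, j = k + 1 := ⟨j - 1, by omega⟩
    rw [wB_succ hi, wB_succ (by omega)]
    exact h j (by omega) (by omega)

section SplitAtOne

variable {a b : List ℕ}

lemma wB_append_left (c : ℕ) {i : ℕ} (hi : i < a.length) : wB (a ++ c :: b) (i + 1) = a[i] := by
  rw [wB_succ (by simp; omega), List.getD_append _ _ _ _ hi, List.getD_eq_getElem]

lemma wB_append_mid (c : ℕ) : wB (a ++ c :: b) (a.length + 1) = c := by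
  rw [wB_succ (by simp), List.getD_append_right _ _ _ _ le_rfl]
  simp

lemma one_lt_wB (ha : ∀ x ∈ a, 1 < x) (hb : ∀ x ∈ b, 1 < x) {i : ℕ} (hi : 1 ≤ i)
    (hne : i ≠ a.length + 1) : 1 < wB (a ++ 1 :: b) i := by
  obtain ⟨i, rfl⟩ : ∃ k, i = k + 1 := ⟨i - 1, by omega⟩
  rcases Nat.lt_or_ge i a.length with h | h
  · rw [wB_append_left 1 h]
    exact ha _ (List.getElem_mem h)
  · rcases Nat.lt_or_ge i (a ++ 1 :: b).length with h' | h'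
    · rw [wB_succ h', List.getD_append_right _ _ _ _ h]
      obtain ⟨k, hk⟩ : ∃ k, i - a.length = k + 1 := ⟨i - a.length - 1, by omega⟩
      have hkb : k < b.length := by
        simp at h'
        omega
      rw [hk, List.getD_cons_succ, List.getD_eq_getElem _ _ hkb]
      exact hb _ (List.getElem_mem hkb)
    · rw [wB, if_neg (by omega)]
      simp

lemma isPRW_append_iff (ha : ∀ x ∈ a, 1 < x) (hb : ∀ x ∈ b, 1 < x) (hn : a.Nodup) :
    isPRW (a ++ 1 :: b) ↔ a.Pairwise (· > ·) := by
  set l := a ++ 1 :: b with hl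
  have hlen : l.length = a.length + b.length + 1 := by
    simp [hl]
    omega
  constructor
  · intro h
    have hasc : ∀ i ∈ Finset.Icc 1 (l.length - 1), wB l i < wB l (i + 1) → a.length + 1 ≤ i := by
      intro i
      induction i using Nat.strong_induction_on with
      | _ i ih =>
        intro hi hi'
        by_contra hlt
        have hmin : ∀ j ∈ Finset.Icc 1 (i - 1), ¬ wB l j < wB l (j + 1) := by
          intro j hj hj'
          rw [Finset.mem_Icc] at hi hj
          have := ih j (by omega) (Finset.mem_Icc.2 ⟨by omega, by omega⟩) hj'
          omega
        have h1 := h i hi hi' hmin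
        have h2 := one_lt_wB ha hb (Finset.mem_Icc.1 hi).1 (by omega : i ≠ a.length + 1)
        rw [← hl] at h2
        omega
    rw [← List.isChain_iff_pairwise, List.isChain_iff_getElem]
    intro i hi
    have h1 : ¬ wB l (i + 1) < wB l (i + 1 + 1) := fun h' => by
      have := hasc (i + 1) (Finset.mem_Icc.2 ⟨by omega, by omega⟩) h'
      omega
    rw [hl, wB_append_left 1 (by omega), wB_append_left 1 hi] at h1
    refine lt_of_le_of_ne (not_lt.1 h1) fun h' => ?_
    have := (hn.getElem_inj_iff).1 h'
    omega
  · intro h i hi hi' hmin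
    rw [Finset.mem_Icc] at hi
    rcases lt_trichotomy i (a.length + 1) with h1 | rfl | h1
    · exfalso
      obtain ⟨i, rfl⟩ : ∃ k, i = k + 1 := ⟨i - 1, by omega⟩
      rcases Nat.lt_or_ge (i + 1) a.length with h2 | h2
      · rw [hl, wB_append_left 1 (by omega), wB_append_left 1 h2] at hi'
        have := List.pairwise_iff_getElem.1 h i (i + 1) (by omega) h2 (by omega)
        omega
      · have h3 : i + 1 = a.length := by omega
        have h4 := one_lt_wB ha hb hi.1 (by omega : i + 1 ≠ a.length + 1)
        rw [← hl] at h4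
        rw [h3, wB_append_mid] at hi'
        rw [h3] at h4
        omega
    · exact wB_append_mid 1
    · refine absurd ?_ (hmin (a.length + 1) (Finset.mem_Icc.2 ⟨by omega, by omega⟩))
      rw [hl, wB_append_mid]
      exact one_lt_wB ha hb (by omega) (by omega)

lemma lrminW_append (ha : ∀ x ∈ a, 1 < x) (hb : ∀ x ∈ b, 1 < x) (hd : a.Pairwise (· > ·)) :
    lrminW (a ++ 1 :: b) = a.length + 1 := by
  have : (Finset.Icc 1 (a ++ 1 :: b).length).filter (isLRat (a ++ 1 :: b)) =
      Finset.Icc 1 (a.length + 1) := by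
    ext i
    simp only [Finset.mem_filter, Finset.mem_Icc, isLRat, List.length_append, List.length_cons]
    constructor
    · rintro ⟨⟨h1, h2⟩, h3⟩
      refine ⟨h1, ?_⟩
      by_contra h4
      have h5 := h3 (a.length + 1) ⟨by omega, by omega⟩
      have h6 := one_lt_wB ha hb h1 (by omega : i ≠ a.length + 1)
      rw [wB_append_mid] at h5
      omega
    · rintro ⟨h1, h2⟩
      refine ⟨⟨h1, by omega⟩, fun j hj => ?_⟩
      rcases Nat.lt_or_ge i (a.length + 1) with h3 | h3
      · obtain ⟨i, rfl⟩ : ∃ k, i = k + 1 := ⟨i - 1, by omega⟩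
        obtain ⟨j, rfl⟩ : ∃ k, j = k + 1 := ⟨j - 1, by omega⟩
        rw [wB_append_left 1 (by omega), wB_append_left 1 (by omega)]
        exact List.pairwise_iff_getElem.1 hd j i (by omega) (by omega) (by omega)
      · obtain rfl : i = a.length + 1 := by omega
        rw [wB_append_mid]
        exact one_lt_wB ha hb (by omega) (by omega)
  rw [lrminW, this]
  simp

lemma wordWeight_append (u v w : ℝ) (ha : ∀ x ∈ a, 1 < x) (hb : ∀ x ∈ b, 1 < x)
    (hd : a.Pairwise (· > ·)) :
    wordWeight u v w (a ++ 1 :: b) = v ^ a.length * wordWeight u v w (0 :: b) := by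
  rw [← wordWeight_cons_congr u v w hb fun x hx => zero_lt_one.trans (hb x hx)]
  have hd' : (a ++ [1]).Pairwise (· > ·) := by
    rw [List.pairwise_append]
    exact ⟨hd, by simp, by simpa using ha⟩
  rcases List.eq_nil_or_concat a with rfl | ⟨a, p, rfl⟩
  · simp
  · have := wordWeight_of_decreasing u v w _ hd'
    simp only [List.concat_eq_append, List.append_assoc, List.cons_append, List.nil_append] at this ⊢
    rw [wordWeight_append_of_desc u v w (ha p (by simp)), this]
    simp

end SplitAtOne

lemma sum_arrangements_decreasing (A : Finset ℕ) (f : ℕ → ℝ) :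
    ∑ a ∈ arrangements A, (if a.Pairwise (· > ·) then f a.length else 0) = f A.card := by
  have hmem : A.sort (· ≥ ·) ∈ arrangements A := by
    rw [mem_arrangements]
    exact ⟨A.sort_nodup _, A.sort_toFinset _⟩
  have hdec : (A.sort (· ≥ ·)).Pairwise (· > ·) := A.sortedGT_sort.pairwise
  rw [Finset.sum_eq_single_of_mem _ hmem, if_pos hdec, Finset.length_sort]
  intro b hb hne
  refine if_neg fun h => hne ?_
  rw [mem_arrangements] at hb
  have hp : b.Perm (A.sort (· ≥ ·)) := List.perm_of_nodup_nodup_toFinset_eq hb.1 (A.sort_nodup _)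
    (by rw [hb.2, A.sort_toFinset])
  exact hp.eq_of_pairwise (fun x y _ _ h1 h2 => absurd h1 h2.not_gt) h hdec

lemma word_mem_arrangements {n : ℕ} (σ : Equiv.Perm (Fin n)) :
    word σ ∈ arrangements (Finset.Icc 1 n) := by
  rw [mem_arrangements]
  constructor
  · rw [word, List.nodup_ofFn]
    intro i j h
    exact σ.injective (Fin.ext (by simpa using h))
  · ext x
    simp only [word, List.mem_toFinset, List.mem_ofFn, Finset.mem_Icc]
    constructor
    · rintro ⟨i, rfl⟩
      have := (σ i).isLt
      omega
    · rintro ⟨h1, h2⟩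
      refine ⟨σ.symm ⟨x - 1, by omega⟩, ?_⟩
      simp
      omega

lemma exists_word_eq {n : ℕ} {l : List ℕ} (hl : l ∈ arrangements (Finset.Icc 1 n)) :
    ∃ σ : Equiv.Perm (Fin n), word σ = l := by
  rw [mem_arrangements] at hl
  obtain ⟨hn, hs⟩ := hl
  have hlen : l.length = n := by
    rw [← List.toFinset_card_of_nodup hn, hs]
    simp
  have hmem : ∀ i (h : i < l.length), 1 ≤ l[i] ∧ l[i] ≤ n := by
    intro i h
    rw [← Finset.mem_Icc, ← hs, List.mem_toFinset]
    exact List.getElem_mem h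
  let f : Fin n → Fin n := fun i =>
    ⟨l[(i : ℕ)]'(hlen ▸ i.isLt) - 1, by have := hmem i (hlen ▸ i.isLt); omega⟩
  have hf : Function.Injective f := by
    intro i j h
    have h1 := hmem i (hlen ▸ i.isLt)
    have h2 := hmem j (hlen ▸ j.isLt)
    have h3 := congrArg Fin.val h
    simp only [f] at h3
    exact Fin.ext (hn.getElem_inj_iff.1 (by omega))
  refine ⟨Equiv.ofBijective f (Finite.injective_iff_bijective.1 hf), ?_⟩
  refine List.ext_getElem (by simp [word, hlen]) fun i h1 h2 => ?_
  have := hmem i h2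
  simp [word, f]
  omega

lemma sum_PRW (n : ℕ) (f : List ℕ → ℝ) : ∑ σ ∈ PRW n, f (word σ) =
    ∑ l ∈ arrangements (Finset.Icc 1 n), if isPRW l then f l else 0 := by
  rw [PRW, Finset.sum_filter]
  refine Finset.sum_bij (fun σ _ => word σ) (fun σ _ => word_mem_arrangements σ) ?_ ?_
    (fun _ _ => rfl)
  · intro σ _ τ _ h
    ext i
    have := congrFun (List.ofFn_injective h) i
    simpa using this
  · intro l hl
    obtain ⟨σ, hσ⟩ := exists_word_eq hl
    exact ⟨σ, Finset.mem_univ _, hσ⟩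

lemma sum_PRW_eq_totalSum (n : ℕ) (u v w α : ℝ) :
    ∑ σ ∈ PRW (n + 1), u ^ pkW (word σ) * v ^ desW (word σ) * w ^ ascW (word σ) *
        α ^ (lrminW (word σ) + rlminW (word σ) - 2) =
      totalSum u v w α ((Finset.Icc 1 (n + 1)).erase 1) := by
  have h1 : 1 ∈ Finset.Icc 1 (n + 1) := by simp
  have hmin : ∀ x ∈ Finset.Icc 1 (n + 1), 1 ≤ x := fun x hx => (Finset.mem_Icc.1 hx).1
  rw [sum_PRW (n + 1) fun l => u ^ pkW l * v ^ desW l * w ^ ascW l *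
    α ^ (lrminW l + rlminW l - 2), Finset.sum_congr rfl (g := fun l => if isPRW l then
      wordWeight u v w l * α ^ (lrminW l + rlminW l - 2) else 0),
    sum_arrangements_split h1, totalSum]
  · refine Finset.sum_congr rfl fun A hA => ?_
    have hA := Finset.mem_powerset.1 hA
    rw [← sum_arrangements_decreasing A fun k => (v * α) ^ k, tailSum, Finset.sum_mul_sum]
    refine Finset.sum_congr rfl fun a ha => Finset.sum_congr rfl fun b hb => ?_
    have ha' := lt_of_mem_arrangements hmin hA ha
    have hb' := lt_of_mem_arrangements hmin Finset.sdiff_subset hb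
    have hiff := isPRW_append_iff ha' hb' (mem_arrangements.1 ha).1
    by_cases hd : a.Pairwise (· > ·)
    · rw [if_pos (hiff.2 hd), if_pos hd, wordWeight_append u v w ha' hb' hd,
        lrminW_append ha' hb' hd, rlminW_eq, rightMinima_append ha' hb',
        show a.length + 1 + (1 + rightMinima b) - 2 = a.length + rightMinima b by omega]
      ring
    · rw [if_neg (fun h => hd (hiff.1 h)), if_neg hd, zero_mul]
  · intro l hl
    rw [mem_arrangements] at hl
    rw [weight_word_eq]
    intro x hx
    rw [← List.toFinset_card_of_nodup hl.1, hl.2, Nat.card_Icc]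
    rw [← List.mem_toFinset, hl.2, Finset.mem_Icc] at hx
    omega

/-- Theorem 2.2 of the paper: the joint enumerator of
`(M, des, asc, LRmin + RLmin - 2)` over `PRW_{n+1}` at `(u,v,w,α)` equals the
`(des, asc, LRmin + RLmin - 2)` enumerator at `(x, y, α)`, where
`x, y = ((w+v) ∓ √((w+v)² - 4uvw))/2`. -/
theorem peak_des_asc_enumerator (n : ℕ) (hn : 1 ≤ n) (u v w α : ℝ)
    (h : 4 * u * v * w ≤ (w + v) ^ 2) (x y : ℝ)
    (hx : x = ((w + v) - Real.sqrt ((w + v) ^ 2 - 4 * u * v * w)) / 2)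
    (hy : y = ((w + v) + Real.sqrt ((w + v) ^ 2 - 4 * u * v * w)) / 2) :
    ∑ σ ∈ PRW (n + 1), u ^ pkW (word σ) * v ^ desW (word σ) * w ^ ascW (word σ) *
        α ^ (lrminW (word σ) + rlminW (word σ) - 2)
      = ∑ σ ∈ PRW (n + 1), x ^ desW (word σ) * y ^ ascW (word σ) *
          α ^ (lrminW (word σ) + rlminW (word σ) - 2) := by
  have hxy : u * v * w = 1 * x * y := by
    have hsq := Real.sq_sqrt (sub_nonneg.2 h)
    rw [hx, hy]
    linear_combination (1 / 4) * hsq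
  have hadd : v + w = x + y := by
    rw [hx, hy]
    ring
  have hone := sum_PRW_eq_totalSum n 1 x y α
  simp only [one_pow, one_mul] at hone
  rw [sum_PRW_eq_totalSum, hone]
  refine totalSum_congr hadd hxy α _ fun t ht => ?_
  exact (Finset.mem_Icc.1 (Finset.mem_of_mem_erase ht)).1
end
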